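/- arXiv:1510.05699 — 14 statements merged into one kernel-verified Lean document; each statement's English description precedes it below -/
import Mathlib

section
/- If I is a meager ideal on a countably infinite set X (meager as a subset of the Cantor space 2^X), then there exists a perfect (I,Fin)-almost disjoint family, i.e. a perfect subset 𝒜 of 2^X such that every A ∈ 𝒜 is I-positive and A ∩ B is finite for any two distinct A, B ∈ 𝒜. Moreover, if I is everywhere meager, then for every Y ∈ I⁺ there is a perfect (I,Fin)-almost disjoint family consisting of subsets of Y (perfect as a subset of 2^Y). -/
open Set

/-- `I` is an ideal on `X`: it contains all finite sets, is closed under subsets and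
finite unions, and does not contain `X` itself. -/
def IsIdeal {X : Type*} (I : Set (Set X)) : Prop :=
  (∀ A : Set X, A.Finite → A ∈ I) ∧
  (∀ A B : Set X, A ⊆ B → B ∈ I → A ∈ I) ∧
  (∀ A B : Set X, A ∈ I → B ∈ I → A ∪ B ∈ I) ∧
  (univ : Set X) ∉ I

/-- The subset of `X` decoded from a point of the Cantor space `2^Y`, for `Y ⊆ X`. -/
def decodeOn {X : Type*} (Y : Set X) (f : Y → Bool) : Set X :=
  {x | ∃ h : x ∈ Y, f ⟨x, h⟩ = true}

/-- The restriction `I↾Y` is meager in the Cantor space `2^Y`. -/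
def MeagerOn {X : Type*} (I : Set (Set X)) (Y : Set X) : Prop :=
  IsMeagre {f : Y → Bool | decodeOn Y f ∈ I}

/-- There exists a perfect `(I, Fin)`-almost disjoint family consisting of subsets of `Y`,
perfect as a subset of the Cantor space `2^Y`: a nonempty perfect set `𝒜 ⊆ 2^Y` all of whose
members decode to `I`-positive sets, any two distinct members having finite intersection. -/
def PerfectADFamOn {X : Type*} (I : Set (Set X)) (Y : Set X) : Prop :=
  ∃ 𝒜 : Set (Y → Bool), Perfect 𝒜 ∧ 𝒜.Nonempty ∧
    (∀ f ∈ 𝒜, decodeOn Y f ∉ I) ∧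
    (∀ f ∈ 𝒜, ∀ g ∈ 𝒜, f ≠ g → (decodeOn Y f ∩ decodeOn Y g).Finite)

/-- Given a dense open `U ⊆ 2^X` and a finite `F ⊆ X`, there is a cylinder with support off `F`
whose intersection with the cylinder of `s` over `F` is contained in `U`, simultaneously for all
`s` in a finite set. -/
theorem exists_cylinder_finset {X : Type*} {U : Set (X → Bool)} (hU : IsOpen U) (hd : Dense U)
    (F : Finset X) (S : Finset (X → Bool)) :
    ∃ (P : Finset X) (z : X → Bool), Disjoint F P ∧
      ∀ s ∈ S, ∀ f : X → Bool, (∀ x ∈ F, f x = s x) → (∀ x ∈ P, f x = z x) → f ∈ U := by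
  classical
  induction S using Finset.induction_on with
  | empty => exact ⟨∅, fun _ => false, by simp, by simp⟩
  | insert s S _ ih =>
    obtain ⟨P, z, hFP, hP⟩ := ih
    let g : X → Bool := fun x => if x ∈ F then s x else z x
    have hO : IsOpen (Set.pi (↑(F ∪ P) : Set X) fun x => ({g x} : Set Bool)) :=
      isOpen_set_pi (Finset.finite_toSet _) fun _ _ => isOpen_discrete _
    obtain ⟨f₀, hf₀, hf₀U⟩ := hd.inter_open_nonempty _ hO ⟨g, fun _ _ => rfl⟩
    obtain ⟨Q, u, hQ, hQU⟩ := isOpen_pi_iff.1 hU f₀ hf₀U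
    have hF : ∀ x ∈ F, f₀ x = s x := fun x hx => by
      have := hf₀ x (by simp [hx])
      simpa [g, hx] using this
    have hPz : ∀ x ∈ P, f₀ x = z x := fun x hx => by
      have := hf₀ x (by simp [hx])
      simpa [g, Finset.disjoint_right.1 hFP hx] using this
    refine ⟨(P ∪ Q) \ F, f₀, Finset.disjoint_sdiff, fun t ht f hfF hfP => ?_⟩
    rcases Finset.mem_insert.1 ht with rfl | ht
    · refine hQU fun x hx => ?_
      have : f x = f₀ x := by
        by_cases hxF : x ∈ F
        · rw [hfF x hxF, hF x hxF]
        · exact hfP x (by simp [hxF, Finset.mem_coe.1 hx])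
      rw [this]
      exact (hQ x hx).2
    · refine hP t ht f hfF fun x hx => ?_
      rw [hfP x (by simp [hx, Finset.disjoint_right.1 hFP hx]), hPz x hx]

/-- A dense open subset of `2^X` contains a nonempty cylinder whose support avoids a given
finite set. -/
theorem exists_cylinder_disjoint {X : Type*} {U : Set (X → Bool)} (hU : IsOpen U) (hd : Dense U)
    (F : Finset X) :
    ∃ (P : Finset X) (z : X → Bool), Disjoint F P ∧
      ∀ f : X → Bool, (∀ x ∈ P, f x = z x) → f ∈ U := by
  classical
  obtain ⟨P, z, hFP, hP⟩ := exists_cylinder_finset hU hd F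
    (Finset.univ.image fun (s : F → Bool) (x : X) => if h : x ∈ F then s ⟨x, h⟩ else false)
  refine ⟨P, z, hFP, fun f hf => hP _
    (Finset.mem_image_of_mem _ (Finset.mem_univ fun x : F => f x)) f ?_ hf⟩
  intro x hx
  simp [hx]

/-- A comeagre subset of a Baire space contains the intersection of a decreasing sequence of dense
open sets. -/
theorem exists_antitone_dense_open {α : Type*} [TopologicalSpace α] [BaireSpace α] {s : Set α}
    (hs : s ∈ residual α) :
    ∃ G : ℕ → Set α, Antitone G ∧ (∀ n, IsOpen (G n)) ∧ (∀ n, Dense (G n)) ∧ ⋂ n, G n ⊆ s := by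
  obtain ⟨S, hSo, hSd, hSc, hSs⟩ := mem_residual_iff.1 hs
  obtain ⟨u, hu⟩ := (hSc.insert univ).exists_eq_range (insert_nonempty _ _)
  have hmem : ∀ n, u n ∈ insert univ S := fun n => hu ▸ mem_range_self n
  have huo : ∀ n, IsOpen (u n) := fun n => by
    rcases hmem n with h | h
    · rw [h]; exact isOpen_univ
    · exact hSo _ h
  have hud : ∀ n, Dense (u n) := fun n => by
    rcases hmem n with h | h
    · rw [h]; exact dense_univ
    · exact hSd _ h
  refine ⟨fun n => ⋂ i ∈ Iic n, u i, fun m n hmn => biInter_mono (Iic_subset_Iic.2 hmn)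
    fun _ _ => subset_rfl, fun n => (finite_Iic n).isOpen_biInter fun i _ => huo i,
    fun n => dense_biInter_of_isOpen (fun i _ => huo i) (to_countable _) fun i _ => hud i, ?_⟩
  intro x hx
  refine hSs fun t ht => ?_
  obtain ⟨n, rfl⟩ : t ∈ range u := hu ▸ mem_insert_of_mem _ ht
  exact mem_iInter₂.1 (mem_iInter.1 hx n) n (mem_Iic.2 le_rfl)

/-- One direction of Talagrand's characterization: for a downward closed meagre `J ⊆ P(X)` there is
a sequence of disjoint finite sets such that no member of `J` contains infinitely many of them. -/
theorem exists_disjoint_finsets_of_isMeagre {X : Type*} {J : Set (Set X)}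
    (hdown : ∀ A B : Set X, A ⊆ B → B ∈ J → A ∈ J)
    (hJ : IsMeagre {f : X → Bool | {x | f x = true} ∈ J}) :
    ∃ P : ℕ → Finset X, Pairwise (Function.onFun Disjoint P) ∧
      ∀ A : Set X, {n | (P n : Set X) ⊆ A}.Infinite → A ∉ J := by
  classical
  obtain ⟨G, hGa, hGo, hGd, hGJ⟩ := exists_antitone_dense_open hJ
  choose p z hp hz using fun (F : Finset X) (n : ℕ) =>
    exists_cylinder_disjoint (hGo n) (hGd n) F
  let acc : ℕ → Finset X := fun n => Nat.rec ∅ (fun n F => F ∪ p F n) n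
  have hacc : ∀ n, acc (n + 1) = acc n ∪ p (acc n) n := fun n => rfl
  have hmono : Monotone acc := monotone_nat_of_le_succ fun n => by
    rw [hacc]; exact Finset.subset_union_left
  have hdisj : Pairwise (Function.onFun Disjoint fun n => p (acc n) n) := by
    refine (pairwise_disjoint_on _).2 fun m n hmn => ?_
    refine (hp (acc n) n).mono_left (le_trans ?_ (hmono (Nat.succ_le_of_lt hmn)))
    rw [Nat.succ_eq_add_one, hacc]
    exact Finset.subset_union_right
  refine ⟨fun n => p (acc n) n, hdisj, fun A hA hAJ => ?_⟩
  let B : X → Bool := fun x =>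
    decide (∃ n, (p (acc n) n : Set X) ⊆ A ∧ x ∈ p (acc n) n ∧ z (acc n) n x = true)
  have hBA : {x | B x = true} ⊆ A := fun x hx => by
    obtain ⟨n, hn, hxn, -⟩ := of_decide_eq_true hx
    exact hn hxn
  have hBG : B ∈ ⋂ n, G n := by
    refine mem_iInter.2 fun m => ?_
    obtain ⟨n, hn, hmn⟩ := hA.exists_gt m
    refine hGa hmn.le (hz (acc n) n B fun x hx => ?_)
    rw [Bool.eq_iff_iff]
    refine decide_eq_true_iff.trans ⟨?_, fun h => ⟨n, hn, hx, h⟩⟩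
    rintro ⟨k, -, hxk, hk⟩
    obtain rfl : k = n := by
      by_contra hkn
      exact Finset.disjoint_left.1 (hdisj hkn) hxk hx
    exact hk
  exact hGJ hBG (hdown _ _ hBA hAJ)

open Topology Filter in
/-- The range of a continuous injection of the Cantor space into a Hausdorff space is perfect. -/
theorem perfect_range_of_cantor {α : Type*} [TopologicalSpace α] [T2Space α]
    {φ : (ℕ → Bool) → α} (hc : Continuous φ) (hinj : Function.Injective φ) :
    Perfect (range φ) := by
  refine ⟨(isCompact_range hc).isClosed, ?_⟩
  rintro _ ⟨y, rfl⟩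
  refine accPt_iff_nhds.2 fun U hU => ?_
  have ht : Tendsto (fun n => Function.update y n (!y n)) atTop (𝓝 y) := by
    refine tendsto_pi_nhds.2 fun i => tendsto_const_nhds.congr' ?_
    filter_upwards [eventually_gt_atTop i] with n hn
    rw [Function.update_of_ne hn.ne]
  obtain ⟨n, hn⟩ := (ht.eventually (hc.continuousAt hU)).exists
  refine ⟨_, ⟨hn, mem_range_self _⟩, fun h => ?_⟩
  have := congrFun (hinj h) n
  simp at this

open Topology Filter in
/-- A meagre downward closed family containing all finite sets admits a perfect almost disjoint
family of sets outside it. -/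
theorem exists_perfect_almostDisjoint {X : Type*} {J : Set (Set X)}
    (hfin : ∀ A : Set X, A.Finite → A ∈ J) (hdown : ∀ A B : Set X, A ⊆ B → B ∈ J → A ∈ J)
    (hJ : IsMeagre {f : X → Bool | {x | f x = true} ∈ J}) :
    ∃ 𝒜 : Set (X → Bool), Perfect 𝒜 ∧ 𝒜.Nonempty ∧
      (∀ f ∈ 𝒜, {x | f x = true} ∉ J) ∧
      (∀ f ∈ 𝒜, ∀ g ∈ 𝒜, f ≠ g → ({x | f x = true} ∩ {x | g x = true}).Finite) := by
  classical
  obtain ⟨P, hPd, hPJ⟩ := exists_disjoint_finsets_of_isMeagre hdown hJ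
  let r : (ℕ → Bool) → ℕ → List Bool := fun y k => (List.range k).map y
  have hlen : ∀ y k, (r y k).length = k := fun y k => by simp [r]
  let Q : List Bool → Finset X := fun l => P (Encodable.encode l)
  have hQ : ∀ {x l l'}, x ∈ Q l → x ∈ Q l' → l = l' := fun {x l l'} h h' => by
    by_contra hne
    exact Finset.disjoint_left.1 (hPd (Encodable.encode_injective.ne hne)) h h'
  let φ : (ℕ → Bool) → X → Bool := fun y x => decide (∃ k, x ∈ Q (r y k))
  have hφ : ∀ y x, φ y x = true ↔ ∃ k, x ∈ Q (r y k) := fun y x => decide_eq_true_iff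
  have hpos : ∀ y, {x | φ y x = true} ∉ J := fun y => by
    refine hPJ _ (infinite_of_injective_forall_mem (f := fun k => Encodable.encode (r y k)) ?_ ?_)
    · intro k k' h
      simpa [hlen] using congrArg List.length (Encodable.encode_injective h)
    · exact fun k x hx => (hφ y x).2 ⟨k, hx⟩
  have had : ∀ y y', y ≠ y' → ({x | φ y x = true} ∩ {x | φ y' x = true}).Finite := by
    intro y y' hne
    obtain ⟨i, hi⟩ := Function.ne_iff.1 hne
    refine ((finite_Iic i).biUnion fun k _ => (Q (r y k)).finite_toSet).subset ?_
    rintro x ⟨hx, hx'⟩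
    obtain ⟨k, hk⟩ := (hφ y x).1 hx
    obtain ⟨k', hk'⟩ := (hφ y' x).1 hx'
    have hr := hQ hk hk'
    obtain rfl : k = k' := by simpa [hlen] using congrArg List.length hr
    refine mem_biUnion (mem_Iic.2 (not_lt.1 fun hik => hi ?_)) hk
    exact List.map_inj_left.1 hr i (List.mem_range.2 hik)
  have hinj : Function.Injective φ := fun y y' h => by
    by_contra hne
    have := had y y' hne
    rw [← h, inter_self] at this
    exact hpos y (hfin _ this)
  have hcont : Continuous φ := by
    refine continuous_pi fun x => IsLocallyConstant.continuous ?_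
    refine (IsLocallyConstant.iff_eventually_eq _).2 fun y => ?_
    obtain ⟨N, hN⟩ : ∃ N, ∀ l, x ∈ Q l → l.length ≤ N := by
      by_cases h : ∃ l, x ∈ Q l
      · obtain ⟨l, hl⟩ := h
        exact ⟨l.length, fun l' hl' => (hQ hl hl') ▸ le_rfl⟩
      · exact ⟨0, fun l hl => absurd ⟨l, hl⟩ h⟩
    have hev : ∀ᶠ y' in 𝓝 y, ∀ i ∈ Finset.range N, y' i = y i :=
      (Finset.eventually_all _).2 fun i _ =>
        (continuous_apply i).continuousAt.eventually (eventually_of_mem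
          ((isOpen_discrete {y i}).mem_nhds rfl) fun _ h => h)
    filter_upwards [hev] with y' hy'
    rw [Bool.eq_iff_iff, hφ, hφ]
    have hr : ∀ k ≤ N, r y' k = r y k := fun k hk => List.map_inj_left.2 fun i hi =>
      hy' i (Finset.mem_range.2 ((List.mem_range.1 hi).trans_le hk))
    refine exists_congr fun k => ⟨fun h => ?_, fun h => ?_⟩
    · rwa [← hr k (by simpa [hlen] using hN _ h)]
    · rwa [hr k (by simpa [hlen] using hN _ h)]
  refine ⟨range φ, perfect_range_of_cantor hcont hinj, range_nonempty _, ?_, ?_⟩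
  · rintro _ ⟨y, rfl⟩
    exact hpos y
  · rintro _ ⟨y, rfl⟩ _ ⟨y', rfl⟩ hne
    exact had y y' fun h => hne (h ▸ rfl)

theorem decodeOn_eq_image {X : Type*} (Y : Set X) (f : Y → Bool) :
    decodeOn Y f = Subtype.val '' {y | f y = true} := by
  ext x
  simp [decodeOn]

theorem stmt0 {X : Type*} [Countable X] [Infinite X] (I : Set (Set X)) (hI : IsIdeal I) :
    (IsMeagre {f : X → Bool | {x | f x = true} ∈ I} →
      ∃ 𝒜 : Set (X → Bool), Perfect 𝒜 ∧ 𝒜.Nonempty ∧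
        (∀ f ∈ 𝒜, {x | f x = true} ∉ I) ∧
        (∀ f ∈ 𝒜, ∀ g ∈ 𝒜, f ≠ g → ({x | f x = true} ∩ {x | g x = true}).Finite)) ∧
    ((∀ Y : Set X, Y ∉ I → MeagerOn I Y) →
      ∀ Y : Set X, Y ∉ I → PerfectADFamOn I Y) := by
  obtain ⟨hfin, hdown, -, -⟩ := hI
  refine ⟨exists_perfect_almostDisjoint hfin hdown, fun h Y hY => ?_⟩
  have hm := h Y hY
  simp only [MeagerOn, PerfectADFamOn, decodeOn_eq_image,
    ← image_inter Subtype.val_injective] at hm ⊢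
  obtain ⟨𝒜, hp, hne, hpos, had⟩ := exists_perfect_almostDisjoint
    (J := {A : Set Y | Subtype.val '' A ∈ I}) (fun A hA => hfin _ (hA.image _))
    (fun A B hAB hB => hdown _ _ (image_mono hAB) hB) hm
  exact ⟨𝒜, hp, hne, hpos, fun f hf g hg hfg => (had f hf g hg hfg).image _⟩
end

section
/- Let I be an everywhere meager ideal on a countably infinite set X and let H ⊆ I⁺ be a family of I-positive sets of cardinality strictly less than the continuum 𝔠. Then H has an I-almost disjoint refinement: a family {A_H : H ∈ H} such that A_H ⊆ H and A_H ∈ I⁺ for every H ∈ H, and A_{H₀} ∩ A_{H₁} ∈ I for all distinct H₀, H₁ ∈ H. -/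
open Set

/-- Flipping the coordinates in a finite set, as a homeomorphism of the Cantor space `2^Y`. -/
noncomputable def flipHomeo {Y : Type*} (s : Set Y) : (Y → Bool) ≃ₜ (Y → Bool) := by
  classical
  have hinv : Function.Involutive
      (fun (f : Y → Bool) (x : Y) => (f x ^^ decide (x ∈ s))) := fun f => by
    funext x
    simp
  exact
    { toEquiv := hinv.toPerm
      continuous_toFun := continuous_pi fun x =>
        (continuous_of_discreteTopology (f := fun b : Bool => (b ^^ decide (x ∈ s)))).comp
          (continuous_apply x)
      continuous_invFun := continuous_pi fun x =>
        (continuous_of_discreteTopology (f := fun b : Bool => (b ^^ decide (x ∈ s)))).comp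
          (continuous_apply x) }

open Classical in
theorem flipHomeo_apply {Y : Type*} (s : Set Y) (f : Y → Bool) (x : Y) :
    flipHomeo s f x = (f x ^^ decide (x ∈ s)) := rfl

/-- A dense open subset of `2^Y` contains all functions with some prescribed finite pattern
located outside a given finite set. -/
theorem exists_pattern_of_dense_open {Y : Type*} {U : Set (Y → Bool)} (hU : IsOpen U)
    (hd : Dense U) (F : Finset Y) :
    ∃ (E : Finset Y) (p : Y → Bool), Disjoint F E ∧
      ∀ f : Y → Bool, (∀ x ∈ E, f x = p x) → f ∈ U := by
  classical
  have hDo : IsOpen (⋂ s ∈ F.powerset, flipHomeo (s : Set Y) ⁻¹' U) :=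
    isOpen_biInter_finset fun s _ => hU.preimage (flipHomeo _).continuous
  have hDd : Dense (⋂ s ∈ (F.powerset : Set (Finset Y)), flipHomeo (s : Set Y) ⁻¹' U) :=
    dense_biInter_of_isOpen (fun s _ => hU.preimage (flipHomeo _).continuous)
      (Finset.countable_toSet _) (fun s _ => hd.preimage (flipHomeo _).isOpenMap)
  obtain ⟨p, hp⟩ := hDd.nonempty
  obtain ⟨E, u, hu, hEu⟩ := isOpen_pi_iff.1 hDo p hp
  refine ⟨E \ F, p, Finset.disjoint_sdiff, fun f hf => ?_⟩
  set s : Finset Y := F.filter fun x => f x ≠ p x with hs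
  have hmem : flipHomeo (s : Set Y) f ∈ ⋂ s ∈ F.powerset, flipHomeo (s : Set Y) ⁻¹' U := by
    refine hEu fun x hx => ?_
    have hx' : flipHomeo (s : Set Y) f x = p x := by
      rw [flipHomeo_apply]
      by_cases hxF : x ∈ F
      · by_cases hfp : f x = p x
        · simp [hs, hfp]
        · have : x ∈ (s : Set Y) := by simp [hs, hxF, hfp]
          simp only [this, decide_true]
          cases h1 : f x <;> cases h2 : p x <;> simp_all
      · have : x ∉ (s : Set Y) := by simp [hs, hxF]
        simp only [this, decide_false, Bool.xor_false]
        exact hf x (Finset.mem_sdiff.2 ⟨hx, hxF⟩)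
    rw [hx']
    exact (hu x hx).2
  have h := mem_iInter₂.1 hmem s (Finset.mem_powerset.2 (Finset.filter_subset _ _))
  have hff : flipHomeo (s : Set Y) (flipHomeo (s : Set Y) f) = f := by
    funext x
    simp [flipHomeo_apply]
  rwa [mem_preimage, hff] at h

/-- If `M` is meager in `2^Y`, there are pairwise disjoint finite sets whose unions along infinite
index sets have characteristic function outside `M`. -/
theorem exists_disjoint_finsets_of_isMeagre_s1 {Y : Type*} {M : Set (Y → Bool)} (hM : IsMeagre M) :
    ∃ P : ℕ → Finset Y, Pairwise (fun m n => Disjoint (P m) (P n)) ∧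
      ∀ A : Set ℕ, A.Infinite → ∀ f : Y → Bool,
        (∀ x, f x = true ↔ ∃ n ∈ A, x ∈ P n) → f ∉ M := by
  classical
  obtain ⟨t, htM, htG, htd⟩ := mem_residual.1 hM
  obtain ⟨U, hUo, rfl⟩ := isGδ_iff_eq_iInter_nat.1 htG
  have key : ∀ (n : ℕ) (F : Finset Y), ∃ (E : Finset Y) (p : Y → Bool), Disjoint F E ∧
      ∀ f : Y → Bool, (∀ x ∈ E, f x = p x) → f ∈ ⋂ k ∈ Finset.range (n + 1), U k :=
    fun n F => exists_pattern_of_dense_open (isOpen_biInter_finset fun k _ => hUo k)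
      (htd.mono fun f hf => mem_iInter₂.2 fun k _ => mem_iInter.1 hf k) F
  choose E p hE hp using key
  let F : ℕ → Finset Y := fun n => Nat.rec ∅ (fun n G => G ∪ E n G) n
  have hFs : ∀ n, F (n + 1) = F n ∪ E n (F n) := fun n => rfl
  have hFm : Monotone F := monotone_nat_of_le_succ fun n => by
    rw [hFs]
    exact Finset.subset_union_left
  have hlt : ∀ m n, m < n → Disjoint (E m (F m)) (E n (F n)) := fun m n hmn =>
    (hE n (F n)).mono_left
      ((Finset.subset_union_right.trans (hFs m).ge).trans (hFm hmn))
  have hdisj : Pairwise fun m n => Disjoint (E m (F m)) (E n (F n)) := fun m n hmn => by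
    rcases lt_or_gt_of_ne hmn with h | h
    · exact hlt m n h
    · exact (hlt n m h).symm
  refine ⟨fun n => (E n (F n)).filter fun x => p n (F n) x = true, fun m n hmn =>
    (hdisj hmn).mono (Finset.filter_subset _ _) (Finset.filter_subset _ _), ?_⟩
  intro A hA f hf hfM
  refine htM (mem_iInter.2 fun k => ?_) hfM
  obtain ⟨n, hnA, hkn⟩ := hA.exists_gt k
  refine mem_iInter₂.1 (hp n (F n) f fun x hx => ?_) k (Finset.mem_range.2 (by omega))
  rw [Bool.eq_iff_iff, hf]
  constructor
  · rintro ⟨m, -, hm⟩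
    obtain ⟨hm, hpm⟩ := Finset.mem_filter.1 hm
    have : m = n := by
      by_contra hne
      exact Finset.disjoint_left.1 (hdisj hne) hm hx
    rwa [← this]
  · exact fun h => ⟨n, hnA, Finset.mem_filter.2 ⟨hx, h⟩⟩

/-- There is an almost disjoint family of infinite subsets of `ℕ` indexed by `2^ℕ`. -/
theorem exists_almost_disjoint_family :
    ∃ A : (ℕ → Bool) → Set ℕ, (∀ ξ, (A ξ).Infinite) ∧
      Pairwise fun ξ η => (A ξ ∩ A η).Finite := by
  let e : (ℕ → Bool) → ℕ → ℕ := fun ξ n => Encodable.encode ((List.range n).map ξ)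
  have he : ∀ ξ η m n, e ξ m = e η n → m = n ∧ ∀ k < m, ξ k = η k := by
    intro ξ η m n h
    have h := Encodable.encode_injective h
    have hmn : m = n := by simpa using congrArg List.length h
    subst hmn
    refine ⟨rfl, fun k hk => ?_⟩
    exact List.map_inj_left.1 h k (List.mem_range.2 hk)
  refine ⟨fun ξ => range (e ξ),
    fun ξ => infinite_range_of_injective fun m n h => (he ξ ξ m n h).1, fun ξ η hne => ?_⟩
  obtain ⟨k, hk⟩ := Function.ne_iff.1 hne
  refine ((finite_Iic k).image (e ξ)).subset ?_
  rintro _ ⟨⟨m, rfl⟩, ⟨n, hn⟩⟩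
  refine ⟨m, ?_, rfl⟩
  by_contra hm
  exact hk ((he ξ η m n hn.symm).2 k (by simpa using hm))

/-- If `I↾Y` is meager, then `Y` carries continuum many positive sets with pairwise
intersections in `I`. -/
theorem exists_ad_family_of_meagerOn {X : Type*} {I : Set (Set X)}
    (hfin : ∀ A : Set X, A.Finite → A ∈ I) {Y : Set X} (hY : MeagerOn I Y) :
    ∃ B : (ℕ → Bool) → Set X, (∀ ξ, B ξ ⊆ Y ∧ B ξ ∉ I) ∧
      Pairwise fun ξ η => B ξ ∩ B η ∈ I := by
  classical
  obtain ⟨P, hPd, hP⟩ := exists_disjoint_finsets_of_isMeagre_s1 hY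
  obtain ⟨A, hA, hAd⟩ := exists_almost_disjoint_family
  refine ⟨fun ξ => decodeOn Y fun x => decide (∃ n ∈ A ξ, x ∈ P n), fun ξ => ⟨?_, ?_⟩,
    fun ξ η hne => hfin _ ?_⟩
  · rintro x ⟨hx, -⟩
    exact hx
  · exact hP (A ξ) (hA ξ) _ fun x => by simp
  · refine (((hAd hne).biUnion fun n _ => (P n).finite_toSet).image Subtype.val).subset ?_
    rintro x ⟨⟨hx, h1⟩, ⟨_, h2⟩⟩
    obtain ⟨m, hm, hxm⟩ := of_decide_eq_true h1
    obtain ⟨n, hn, hxn⟩ := of_decide_eq_true h2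
    have hmn : m = n := by
      by_contra hne
      exact Finset.disjoint_left.1 (hPd hne) hxm hxn
    subst hmn
    exact ⟨⟨x, hx⟩, mem_iUnion₂.2 ⟨m, ⟨hm, hn⟩, hxm⟩, rfl⟩

universe u v

/-- A family of sets, each larger than the index type, has an injective choice function. -/
theorem exists_injective_choice {ι : Type u} {α : Type v} (S : ι → Set α)
    (hS : ∀ i, Cardinal.lift.{v} (Cardinal.mk ι) < Cardinal.lift.{u} (Cardinal.mk (S i))) :
    ∃ f : ι → α, Function.Injective f ∧ ∀ i, f i ∈ S i := by
  have wf : WellFounded (WellOrderingRel : ι → ι → Prop) := IsWellFounded.wf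
  have key : ∀ (i : ι) (g : ∀ j, WellOrderingRel j i → α),
      ∃ a ∈ S i, ∀ j hj, g j hj ≠ a := by
    intro i g
    by_contra! hcon
    refine (hS i).not_ge ?_
    have hle : ∀ a : S i, ∃ j : ι, ∃ hj, g j hj = a := fun a => hcon a a.2
    choose j hj hg using hle
    refine Cardinal.lift_mk_le_lift_mk_of_injective (f := j) fun a b hab => Subtype.ext ?_
    rw [← hg a, ← hg b]
    congr
  choose c hcS hc using key
  refine ⟨wf.fix c, ?_, fun i => ?_⟩
  · have hne : ∀ i j, WellOrderingRel j i → wf.fix c j ≠ wf.fix c i := fun i j hji => by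
      rw [wf.fix_eq c i]
      exact hc i (fun j _ => wf.fix c j) j hji
    intro i j hij
    rcases trichotomous_of WellOrderingRel i j with h | h | h
    · exact absurd hij (hne _ _ h)
    · exact h
    · exact absurd hij.symm (hne _ _ h)
  · rw [wf.fix_eq]
    exact hcS _ _

/-- If `I` is an everywhere meager ideal on a countably infinite set `X` and
`H ⊆ I⁺` has size `< 𝔠`, then `H` has an `I`-almost disjoint refinement. -/
theorem stmt1 {X : Type*} [Countable X] [Infinite X] (I : Set (Set X)) (hI : IsIdeal I)
    (hEM : ∀ Y : Set X, Y ∉ I → MeagerOn I Y)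
    (H : Set (Set X)) (hH : ∀ A ∈ H, A ∉ I)
    (hcard : Cardinal.mk H < Cardinal.continuum) :
    ∃ A : Set X → Set X, ∀ H₀ ∈ H, A H₀ ⊆ H₀ ∧ A H₀ ∉ I ∧
      ∀ H₁ ∈ H, H₀ ≠ H₁ → A H₀ ∩ A H₁ ∈ I := by
  classical
  obtain ⟨hfin, hsub, -, -⟩ := hI
  set κ : Cardinal := max (Cardinal.mk H) Cardinal.aleph0
  have hκc : κ < Cardinal.continuum := max_lt hcard Cardinal.aleph0_lt_continuum
  have hB : ∀ Y : H, ∃ B : (ℕ → Bool) → Set X, (∀ ξ, B ξ ⊆ Y ∧ B ξ ∉ I) ∧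
      Pairwise fun ξ η => B ξ ∩ B η ∈ I :=
    fun Y => exists_ad_family_of_meagerOn hfin (hEM Y (hH Y Y.2))
  choose B hBY hBd using hB
  let hits : H → H → Set (ℕ → Bool) := fun b c => {ξ | (b : Set X) ∩ B c ξ ∉ I}
  have hself : ∀ b, κ < Cardinal.lift (Cardinal.mk (hits b b)) := by
    intro b
    have : hits b b = univ := eq_univ_of_forall fun ξ => by
      simpa [hits, inter_eq_self_of_subset_right (hBY b ξ).1] using (hBY b ξ).2
    rw [this]
    simpa using hκc
  have wf : WellFounded (WellOrderingRel : H → H → Prop) := IsWellFounded.wf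
  have hg : ∀ b, ∃ c, κ < Cardinal.lift (Cardinal.mk (hits b c)) ∧
      ∀ d, WellOrderingRel d c → Cardinal.lift (Cardinal.mk (hits b d)) ≤ κ := by
    intro b
    obtain ⟨c, hc, hmin⟩ := wf.has_min
      {c | κ < Cardinal.lift (Cardinal.mk (hits b c))} ⟨b, hself b⟩
    exact ⟨c, hc, fun d hd => not_lt.1 fun h => hmin d h hd⟩
  choose g hgl hgs using hg
  let bad : H → Set (ℕ → Bool) := fun c => ⋃ b : {b : H // WellOrderingRel c (g b)}, hits b c
  have hbad : ∀ c, Cardinal.lift (Cardinal.mk (bad c)) ≤ κ := by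
    intro c
    have h1 := Cardinal.mk_iUnion_le_lift
      (fun b : {b : H // WellOrderingRel c (g b)} => hits b c)
    rw [Cardinal.lift_uzero] at h1
    refine h1.trans ((mul_le_mul' (b := κ) ((Cardinal.mk_subtype_le _).trans (le_max_left _ _))
      (ciSup_le' fun b => hgs _ _ b.2)).trans_eq ?_)
    exact Cardinal.mul_eq_self (le_max_right _ _)
  have hS : ∀ b, Cardinal.lift.{0} (Cardinal.mk H) <
      Cardinal.lift (Cardinal.mk (hits b (g b) \ bad (g b) : Set (ℕ → Bool))) := by
    intro b
    by_contra! hle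
    refine (hgl b).not_ge ?_
    have h1 := Cardinal.lift_le.2 (Cardinal.le_mk_sdiff_add_mk (hits b (g b)) (bad (g b)))
    rw [Cardinal.lift_add] at h1
    refine h1.trans ((add_le_add (hle.trans ?_) (hbad _)).trans_eq
      (Cardinal.add_eq_self (le_max_right _ _)))
    rw [Cardinal.lift_uzero]
    exact le_max_left _ _
  obtain ⟨ξ, hξ, hξS⟩ := exists_injective_choice
    (fun b => hits b (g b) \ bad (g b)) hS
  have hlt : ∀ a b : H, WellOrderingRel (g a) (g b) → B (g a) (ξ a) ∩ (b : Set X) ∈ I := by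
    intro a b hab
    by_contra hn
    rw [inter_comm] at hn
    exact (hξS a).2 (mem_iUnion.2 ⟨⟨b, hab⟩, hn⟩)
  refine ⟨fun Y => if h : Y ∈ H then Y ∩ B (g ⟨Y, h⟩) (ξ ⟨Y, h⟩) else ∅, fun Y hY => ?_⟩
  simp only [hY, dite_true]
  refine ⟨inter_subset_left, (hξS ⟨Y, hY⟩).1, fun Z hZ hne => ?_⟩
  simp only [hZ, dite_true]
  rcases trichotomous_of WellOrderingRel (g ⟨Y, hY⟩) (g ⟨Z, hZ⟩) with h | h | h
  · refine hsub _ _ ?_ (hlt _ _ h)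
    exact fun x hx => ⟨hx.1.2, hx.2.1⟩
  · rw [← h]
    refine hsub _ _ ?_ (hBd (g ⟨Y, hY⟩) (hξ.ne (a₁ := ⟨Y, hY⟩) (a₂ := ⟨Z, hZ⟩) ?_))
    · exact fun x hx => ⟨hx.1.2, hx.2.2⟩
    · exact fun h => hne (congrArg Subtype.val h)
  · refine hsub _ _ ?_ (hlt _ _ h)
    exact fun x hx => ⟨hx.2.2, hx.1.1⟩
end

section
/- There exists an ideal I on a countably infinite set X such that I is not meager (as a subset of the Cantor space 2^X) but there exists a perfect (I,Fin)-almost disjoint family, i.e. a perfect subset 𝒜 of 2^X all of whose members are I-positive and any two distinct members of which have finite intersection. Hence the existence of a perfect (I,Fin)-AD family does not imply that I is meager. -/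
open Set

open Filter Topology

theorem mem_nhds_cantor_iff {a : ℕ → Bool} {U : Set (ℕ → Bool)} :
    U ∈ 𝓝 a ↔ ∃ N, ∀ b : ℕ → Bool, (∀ i < N, b i = a i) → b ∈ U := by
  constructor
  · intro h
    obtain ⟨V, hVU, hV, haV⟩ := mem_nhds_iff.1 h
    obtain ⟨_, ⟨x, n, rfl⟩, ha, hsub⟩ :=
      (PiNat.isTopologicalBasis_cylinders (fun _ : ℕ => Bool)).exists_subset_of_mem_open haV hV
    exact ⟨n, fun b hb => hVU (hsub fun i hi => (hb i hi).trans (ha i hi))⟩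
  · rintro ⟨N, h⟩
    exact mem_of_superset
      ((PiNat.isOpen_cylinder (fun _ : ℕ => Bool) a N).mem_nhds (PiNat.self_mem_cylinder a N))
      fun b hb => h b hb

/-- Delete from the set coded by `p.1` all points whose image under `π` is not in the set
coded by `p.2`. -/
def restrictLevels (π : ℕ → ℕ) (p : (ℕ → Bool) × (ℕ → Bool)) : ℕ → Bool :=
  fun m => p.1 m && p.2 (π m)

theorem continuous_restrictLevels (π : ℕ → ℕ) : Continuous (restrictLevels π) := by
  refine continuous_pi fun m => ?_
  have : Continuous fun q : Bool × Bool => q.1 && q.2 := continuous_of_discreteTopology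
  exact this.comp (g := fun q : Bool × Bool => q.1 && q.2)
    (f := fun p : (ℕ → Bool) × (ℕ → Bool) => (p.1 m, p.2 (π m))) (by fun_prop)

theorem isOpenMap_restrictLevels {π : ℕ → ℕ} (hπ : Tendsto π atTop atTop) :
    IsOpenMap (restrictLevels π) := by
  refine IsOpenMap.of_nhds_le fun ⟨A, z⟩ s hs => ?_
  rw [mem_map, nhds_prod_eq, mem_prod_iff] at hs
  obtain ⟨U, hU, V, hV, hUV⟩ := hs
  obtain ⟨N, hN⟩ := mem_nhds_cantor_iff.1 hU
  obtain ⟨M, hM⟩ := mem_nhds_cantor_iff.1 hV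
  obtain ⟨K, hK⟩ := tendsto_atTop_atTop.1 hπ (M + (Finset.range N).sup π + 1)
  have hlow : ∀ i, i < N → π i < M + (Finset.range N).sup π + 1 := fun i hi =>
    Nat.lt_succ_of_le ((Finset.le_sup (f := π) (Finset.mem_range.2 hi)).trans
      (Nat.le_add_left _ _))
  set R := M + (Finset.range N).sup π + 1
  refine mem_nhds_cantor_iff.2 ⟨K, fun B hB => ?_⟩
  have hmem : ((fun m => if π m < R then A m else B m), fun n => if n < R then z n else true) ∈
      U ×ˢ V := by
    refine ⟨hN _ fun i hi => if_pos (hlow i hi), hM _ fun i hi => if_pos ?_⟩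
    omega
  suffices h : B = restrictLevels π
      (fun m => if π m < R then A m else B m, fun n => if n < R then z n else true) from
    h ▸ hUV hmem
  ext1 m
  by_cases hm : π m < R
  · have : m < K := not_le.1 fun h => (hK m h).not_gt hm
    simp [restrictLevels, hm, hB m this]
  · simp [restrictLevels, hm]

theorem not_isMeagre_image_notMem {π : ℕ → ℕ} (hπ : Tendsto π atTop atTop)
    (u : Ultrafilter ℕ) :
    ¬ IsMeagre {f : ℕ → Bool | π '' {x | f x = true} ∉ u} := by
  intro h
  let e : (ℕ → Bool) × (ℕ → Bool) ≃ₜ (ℕ → Bool) × (ℕ → Bool) :=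
    (Homeomorph.refl _).prodCongr
      (Homeomorph.piCongrRight fun _ => (Equiv.boolNot.toHomeomorphOfDiscrete))
  have h₁ := h.preimage_of_isOpenMap (continuous_restrictLevels π) (isOpenMap_restrictLevels hπ)
  have h₂ := h₁.preimage_of_isOpenMap e.continuous e.isOpenMap
  have h₃ := h₁.union h₂
  obtain ⟨p, hp⟩ := (dense_of_mem_residual h₃).nonempty
  simp only [mem_compl_iff, mem_union, mem_preimage, mem_ofPred_eq, not_or, not_not] at hp
  obtain ⟨_, ⟨m, hm, rfl⟩, m', hm', hmm⟩ := u.nonempty_of_mem (inter_mem hp.1 hp.2)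
  have hz : p.2 (π m) = true := (Bool.and_eq_true_iff.1 hm).2
  have hz' : (!p.2 (π m')) = true := (Bool.and_eq_true_iff.1 hm').2
  rw [hmm, hz] at hz'
  exact Bool.false_ne_true hz'

/-- The branch of the binary tree determined by `x`; the nodes of level `n` are the numbers
`m` with `Nat.log 2 m = n`, coding the string of their lowest `n` binary digits. -/
def branch (x : ℕ → Bool) : ℕ → Bool :=
  fun m => decide (∀ i < Nat.log 2 m, m.testBit i = x i)

theorem continuous_branch : Continuous branch := by
  refine continuous_iff_continuousAt.2 fun x => tendsto_pi_nhds.2 fun m => ?_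
  refine tendsto_nhds_of_eventually_eq (mem_nhds_cantor_iff.2 ⟨Nat.log 2 m, fun b hb => ?_⟩)
  simp +contextual [branch, hb]

theorem image_log_branch (x : ℕ → Bool) : Nat.log 2 '' {m | branch x m = true} = univ := by
  refine eq_univ_of_forall fun n => ?_
  have hlt := Nat.ofBits_lt_two_pow fun i : Fin n => x i
  have hlog : Nat.log 2 (2 ^ n + Nat.ofBits fun i : Fin n => x i) = n :=
    Nat.log_eq_of_pow_le_of_lt_pow (by omega) (by rw [pow_succ]; omega)
  refine ⟨_, ?_, hlog⟩
  simp only [branch, mem_ofPred_eq, decide_eq_true_eq, hlog]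
  intro i hi
  rw [Nat.testBit_two_pow_add_gt hi, Nat.testBit_ofBits_lt _ _ hi]

theorem finite_branch_inter {x y : ℕ → Bool} (h : x ≠ y) :
    ({m | branch x m = true} ∩ {m | branch y m = true}).Finite := by
  obtain ⟨k, hk⟩ := Function.ne_iff.1 h
  refine (finite_lt_nat (2 ^ (k + 1))).subset fun m ⟨hx, hy⟩ => ?_
  simp only [branch, mem_ofPred_eq, decide_eq_true_eq] at hx hy
  by_contra hm
  have hlog : k < Nat.log 2 m := Nat.le_log_of_pow_le one_lt_two (not_lt.1 hm)
  exact hk ((hx k hlog).symm.trans (hy k hlog))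

theorem branch_injective : Function.Injective branch := by
  intro x y h
  by_contra hne
  have hfin := finite_branch_inter hne
  rw [h, inter_self] at hfin
  have := hfin.image (Nat.log 2)
  rw [image_log_branch] at this
  exact infinite_univ this

theorem perfect_range_branch : Perfect (range branch) := by
  refine ⟨(isCompact_range continuous_branch).isClosed, ?_⟩
  rintro _ ⟨x, rfl⟩
  refine accPt_iff_nhds.2 fun U hU => ?_
  obtain ⟨N, hN⟩ := mem_nhds_cantor_iff.1 (continuous_branch.continuousAt hU)
  refine ⟨branch (Function.update x N (!x N)), ⟨hN _ fun i hi => ?_, mem_range_self _⟩, ?_⟩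
  · rw [Function.update_of_ne hi.ne]
  · intro h
    simpa using congrFun (branch_injective h) N

theorem isIdeal_image_notMem_hyperfilter (π : ℕ → ℕ) (hπ : Function.Surjective π) :
    IsIdeal {A : Set ℕ | π '' A ∉ hyperfilter ℕ} := by
  refine ⟨fun A hA => notMem_hyperfilter_of_finite (hA.image π),
    fun A B hAB hB hA => hB (mem_of_superset hA (image_mono hAB)), fun A B hA hB h => ?_, ?_⟩
  · rw [image_union, Ultrafilter.union_mem_iff] at h
    exact h.elim hA hB
  · rw [mem_ofPred_eq, not_not, image_univ, hπ.range_eq]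
    exact univ_mem

/-- There is a non-meager ideal `I` on a countably infinite set (here `ℕ`) admitting a
perfect `(I, Fin)`-almost disjoint family: a nonempty perfect subset of Cantor space
`2^ℕ` all of whose members are `I`-positive, any two distinct members of which have
finite intersection. -/
theorem stmt2 :
    ∃ I : Set (Set ℕ), IsIdeal I ∧
      ¬ IsMeagre {f : ℕ → Bool | {x | f x = true} ∈ I} ∧
      ∃ 𝒜 : Set (ℕ → Bool), Perfect 𝒜 ∧ 𝒜.Nonempty ∧
        (∀ f ∈ 𝒜, {x | f x = true} ∉ I) ∧
        (∀ f ∈ 𝒜, ∀ g ∈ 𝒜, f ≠ g → ({x | f x = true} ∩ {x | g x = true}).Finite) := by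
  have hsurj : Function.Surjective (Nat.log 2) := fun n => ⟨2 ^ n, Nat.log_pow one_lt_two n⟩
  have hlim : Tendsto (Nat.log 2) atTop atTop :=
    tendsto_atTop_atTop.2 fun n => ⟨2 ^ n, fun _ h => Nat.le_log_of_pow_le one_lt_two h⟩
  refine ⟨_, isIdeal_image_notMem_hyperfilter _ hsurj, not_isMeagre_image_notMem hlim _,
    range branch, perfect_range_branch, range_nonempty _, ?_, ?_⟩
  · rintro _ ⟨x, rfl⟩
    rw [mem_ofPred_eq, not_not, image_log_branch]
    exact univ_mem
  · rintro _ ⟨x, rfl⟩ _ ⟨y, rfl⟩ h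
    exact finite_branch_inter (mt (congrArg branch) h)
end

section
/- Assume 𝔟 = 𝔠, where 𝔟 is the bounding number (the least cardinality of a family F ⊆ ω^ω that is unbounded in the eventual domination order ≤*, where f ≤* g means f(n) ≤ g(n) for all but finitely many n) and 𝔠 is the cardinality of the continuum. Then there exists a non-meager ideal I on ω such that for every X ∈ I⁺ there exists a perfect (I,Fin)-almost disjoint family consisting of subsets of X (perfect as a subset of 2^X). -/
open Set

/-- The bounding number `𝔟`: the least cardinality of a family `F ⊆ ω^ω` which is
unbounded in the eventual domination order `≤*`. -/
noncomputable def boundingNumber : Cardinal :=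
  sInf {c | ∃ F : Set (ℕ → ℕ), Cardinal.mk F = c ∧
    ¬ ∃ g : ℕ → ℕ, ∀ f ∈ F, ∀ᶠ n in Filter.atTop, f n ≤ g n}

/-- The finite unions of members of `G`. -/
def finiteUnions (G : Set (Set ℕ)) : Set (Set ℕ) :=
  {B | ∃ F : Set (Set ℕ), F.Finite ∧ F ⊆ G ∧ B = ⋃₀ F}

/-- If every member of `K` meets the complement of `B` in an infinite set, then this is witnessed
uniformly over `K`. -/
def IsUniform (K : Set (Set ℕ)) : Prop :=
  ∀ B : Set ℕ, (∀ A ∈ K, (A \ B).Infinite) →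
    ∀ n, ∃ m, ∀ A ∈ K, ∃ k, n ≤ k ∧ k < m ∧ k ∈ A \ B

/-- No member of a family in `P` is covered, up to a finite set, by finitely many members of `G`. -/
def KeepsPositive (G : Set (Set ℕ)) (P : Set (Set (Set ℕ))) : Prop :=
  ∀ B ∈ finiteUnions G, ∀ K ∈ P, ∀ A ∈ K, (A \ B).Infinite

/-- `C` contains the intervals `[n, φ n)` for `n` in an infinite set along which these intervals are
pairwise disjoint. -/
def ContainsIntervals (φ : ℕ → ℕ) (C : Set ℕ) : Prop :=
  ∃ e : ℕ → ℕ, StrictMono e ∧ (∀ k, φ (e k) ≤ e (k + 1)) ∧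
    ∀ k j, e k ≤ j → j < φ (e k) → j ∈ C

lemma union_mem_finiteUnions {G : Set (Set ℕ)} {A B : Set ℕ} (hA : A ∈ finiteUnions G)
    (hB : B ∈ finiteUnions G) : A ∪ B ∈ finiteUnions G := by
  obtain ⟨F, hF, hFG, rfl⟩ := hA
  obtain ⟨F', hF', hFG', rfl⟩ := hB
  exact ⟨F ∪ F', hF.union hF', union_subset hFG hFG', sUnion_union F F' |>.symm⟩

lemma mem_finiteUnions_of_mem {G : Set (Set ℕ)} {A : Set ℕ} (hA : A ∈ G) :
    A ∈ finiteUnions G :=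
  ⟨{A}, finite_singleton A, singleton_subset_iff.2 hA, (sUnion_singleton A).symm⟩

lemma finiteUnions_mono {G G' : Set (Set ℕ)} (h : G ⊆ G') : finiteUnions G ⊆ finiteUnions G' :=
  fun _ ⟨F, hF, hFG, e⟩ => ⟨F, hF, hFG.trans h, e⟩

lemma empty_mem_finiteUnions (G : Set (Set ℕ)) : ∅ ∈ finiteUnions G :=
  ⟨∅, finite_empty, empty_subset G, sUnion_empty.symm⟩

lemma exists_subset_union_of_mem_finiteUnions_insert {G : Set (Set ℕ)} {B C : Set ℕ}
    (hB : B ∈ finiteUnions (insert C G)) : ∃ B' ∈ finiteUnions G, B ⊆ B' ∪ C := by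
  obtain ⟨F, hF, hFG, rfl⟩ := hB
  refine ⟨⋃₀ (F \ {C}), ⟨F \ {C}, hF.sdiff, ?_, rfl⟩, ?_⟩
  · rintro x ⟨hx, hxC⟩
    exact (hFG hx).resolve_left hxC
  · rintro x ⟨S, hS, hx⟩
    by_cases hSC : S = C
    · exact Or.inr (hSC ▸ hx)
    · exact Or.inl ⟨S, ⟨hS, hSC⟩, hx⟩

lemma infinite_of_forall_exists_ge {S : Set ℕ} (h : ∀ n, ∃ k, n ≤ k ∧ k ∈ S) : S.Infinite := by
  refine infinite_of_not_bddAbove fun ⟨b, hb⟩ => ?_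
  obtain ⟨k, hk, hkS⟩ := h (b + 1)
  have := hb hkS
  omega

lemma mk_finiteUnions_lt {G : Set (Set ℕ)} (hG : Cardinal.mk G < Cardinal.continuum) :
    Cardinal.mk (finiteUnions G) < Cardinal.continuum := by
  have hsub : finiteUnions G ⊆ range (fun F : Finset G => ⋃₀ (Subtype.val '' (F : Set G))) := by
    rintro B ⟨F, hF, hFG, rfl⟩
    have hfin : (Subtype.val ⁻¹' F : Set G).Finite := hF.preimage Subtype.val_injective.injOn
    refine ⟨hfin.toFinset, ?_⟩
    simp [inter_eq_right.2 hFG]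
  refine ((Cardinal.mk_le_mk_of_subset hsub).trans Cardinal.mk_range_le).trans_lt ?_
  rcases finite_or_infinite G with hfin | hinf
  · exact (Cardinal.mk_lt_aleph0).trans Cardinal.aleph0_lt_continuum
  · rwa [Cardinal.mk_finset_of_infinite]

lemma exists_eventually_bound (h : boundingNumber = Cardinal.continuum) {α : Type}
    (hα : Cardinal.mk α < Cardinal.continuum) (f : α → ℕ → ℕ) :
    ∃ g : ℕ → ℕ, ∀ a, ∀ᶠ n in Filter.atTop, f a n ≤ g n := by
  by_contra hcon
  have hle : boundingNumber ≤ Cardinal.mk (range f) := by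
    refine csInf_le' ⟨range f, rfl, fun ⟨g, hg⟩ => hcon ⟨g, fun a => hg _ ⟨a, rfl⟩⟩⟩
  exact absurd (h ▸ hle) (not_le.2 (Cardinal.mk_range_le.trans_lt hα))

lemma exists_uniform_bound (h : boundingNumber = Cardinal.continuum) {G : Set (Set ℕ)}
    {P : Set (Set (Set ℕ))} (hG : Cardinal.mk G < Cardinal.continuum)
    (hP : Cardinal.mk P < Cardinal.continuum) (hu : ∀ K ∈ P, IsUniform K)
    (hg : KeepsPositive G P) :
    ∃ g : ℕ → ℕ, ∀ B ∈ finiteUnions G, ∀ K ∈ P, ∃ N, ∀ n ≥ N, ∀ A ∈ K,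
      ∃ k, n ≤ k ∧ k < g n ∧ k ∈ A \ B := by
  choose f hf using fun p : finiteUnions G × P =>
    hu p.2 p.2.2 p.1 (hg p.1 p.1.2 p.2 p.2.2)
  have hcard : Cardinal.mk (finiteUnions G × P) < Cardinal.continuum := by
    rw [Cardinal.mk_prod, Cardinal.lift_id, Cardinal.lift_id]
    exact Cardinal.mul_lt_of_lt Cardinal.aleph0_le_continuum (mk_finiteUnions_lt hG) hP
  obtain ⟨g, hg'⟩ := exists_eventually_bound h hcard f
  refine ⟨g, fun B hB K hK => ?_⟩
  obtain ⟨N, hN⟩ := Filter.eventually_atTop.1 (hg' (⟨B, hB⟩, ⟨K, hK⟩))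
  refine ⟨N, fun n hn A hA => ?_⟩
  obtain ⟨k, h1, h2, h3⟩ := hf (⟨B, hB⟩, ⟨K, hK⟩) n A hA
  exact ⟨k, h1, h2.trans_le (hN n hn), h3⟩

lemma strictMono_iterate_of_lt {r : ℕ → ℕ} (hr : ∀ n, n < r n) (a : ℕ) :
    StrictMono fun k => r^[k] a :=
  strictMono_nat_of_lt_succ fun k => by
    rw [Function.iterate_succ_apply']
    exact hr _

lemma exists_containsIntervals_keepsPositive (h : boundingNumber = Cardinal.continuum)
    {G : Set (Set ℕ)} {P : Set (Set (Set ℕ))} (hG : Cardinal.mk G < Cardinal.continuum)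
    (hP : Cardinal.mk P < Cardinal.continuum) (hu : ∀ K ∈ P, IsUniform K)
    (hg : KeepsPositive G P) (φ : ℕ → ℕ) :
    ∃ C, ContainsIntervals φ C ∧ KeepsPositive (insert C G) P := by
  obtain ⟨g, hgb⟩ := exists_uniform_bound h hG hP hu hg
  set ψ : ℕ → ℕ := fun n => max n (φ n) with hψ
  have hψ1 : ∀ n, n ≤ ψ n := fun n => le_max_left _ _
  have hψ2 : ∀ n, φ n ≤ ψ n := fun n => le_max_right _ _
  set r : ℕ → ℕ := fun n => ψ n + g (ψ n) + 1 with hr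
  set e : ℕ → ℕ := fun k => r^[k] 0 with he
  have hmono : StrictMono e := strictMono_iterate_of_lt (fun n => by
    have := hψ1 n
    simp only [hr]
    omega) 0
  have hsucc : ∀ k, e (k + 1) = ψ (e k) + g (ψ (e k)) + 1 := fun k => by
    simp only [he, Function.iterate_succ_apply', hr]
  refine ⟨{j | ∃ k, e k ≤ j ∧ j < φ (e k)}, ⟨e, hmono, fun k => ?_, fun k j h1 h2 => ⟨k, h1, h2⟩⟩,
    fun B hB K hK A hA => ?_⟩
  · have := hψ2 (e k)
    rw [hsucc]
    omega
  · obtain ⟨B', hB', hBB'⟩ := exists_subset_union_of_mem_finiteUnions_insert hB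
    obtain ⟨N, hN⟩ := hgb B' hB' K hK
    refine infinite_of_forall_exists_ge fun n => ?_
    set k := max n N
    have hk : k ≤ ψ (e k) := (hmono.id_le k).trans (hψ1 _)
    obtain ⟨j, h1, h2, h3⟩ := hN (ψ (e k)) ((le_max_right n N).trans hk) A hA
    refine ⟨j, ((le_max_left n N).trans hk).trans h1, h3.1, fun hjB => ?_⟩
    rcases hBB' hjB with hj | ⟨l, hl1, hl2⟩
    · exact h3.2 hj
    · rcases le_or_gt l k with hlk | hlk
      · have h4 : j < ψ (e l) := hl2.trans_le (hψ2 _)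
        rcases hlk.eq_or_lt with rfl | hlt
        · omega
        · have h5 := hsucc l
          have h6 : e (l + 1) ≤ e k := hmono.monotone hlt
          have h7 := hψ1 (e k)
          omega
      · have h5 := hsucc k
        have h6 : e (k + 1) ≤ e l := hmono.monotone hlk
        omega

lemma isUniform_singleton (D : Set ℕ) : IsUniform {D} := by
  intro B hB n
  obtain ⟨k, hk, hnk⟩ := (hB D rfl).exists_gt n
  refine ⟨k + 1, ?_⟩
  rintro _ rfl
  exact ⟨k, hnk.le, Nat.lt_succ_self k, hk⟩

lemma isUniform_image_decodeOn {X : Set ℕ} {𝒜 : Set (X → Bool)} (h𝒜 : IsCompact 𝒜) :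
    IsUniform (decodeOn X '' 𝒜) := by
  intro B hB n
  have hopen : ∀ m, IsOpen {f : X → Bool | ∃ k, n ≤ k ∧ k < m ∧ k ∈ decodeOn X f \ B} := by
    intro m
    have : {f : X → Bool | ∃ k, n ≤ k ∧ k < m ∧ k ∈ decodeOn X f \ B} =
        ⋃ k : X, ⋃ (_ : n ≤ (k : ℕ) ∧ (k : ℕ) < m ∧ (k : ℕ) ∉ B), (fun f => f k) ⁻¹' {true} := by
      ext f
      simp only [decodeOn, mem_ofPred_eq, mem_sdiff, mem_iUnion, mem_preimage, mem_singleton_iff]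
      constructor
      · rintro ⟨k, h1, h2, ⟨hk, h3⟩, h4⟩
        exact ⟨⟨k, hk⟩, ⟨h1, h2, h4⟩, h3⟩
      · rintro ⟨k, ⟨h1, h2, h4⟩, h3⟩
        exact ⟨k, h1, h2, ⟨k.2, h3⟩, h4⟩
    rw [this]
    exact isOpen_iUnion fun k => isOpen_iUnion fun _ =>
      (isOpen_discrete _).preimage (continuous_apply k)
  obtain ⟨m, hm⟩ := h𝒜.elim_directed_cover _ hopen (fun f hf => by
    obtain ⟨k, hk, hnk⟩ := (hB _ ⟨f, hf, rfl⟩).exists_gt n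
    exact mem_iUnion.2 ⟨k + 1, k, hnk.le, Nat.lt_succ_self k, hk⟩)
    (directed_of_isDirected_le fun a b hab f ⟨k, h1, h2, h3⟩ => ⟨k, h1, h2.trans_le hab, h3⟩)
  refine ⟨m, ?_⟩
  rintro _ ⟨f, hf, rfl⟩
  exact hm hf

/-- A code for the restriction of `x` to the first `l` coordinates. -/
def branchCode (x : ℕ → Bool) (l : ℕ) : ℕ :=
  Nat.pair l (Encodable.encode fun i : Fin l => x i)

lemma le_branchCode (x : ℕ → Bool) (l : ℕ) : l ≤ branchCode x l := Nat.left_le_pair _ _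

lemma branchCode_eq {x y : ℕ → Bool} {l l' : ℕ} (h : branchCode x l = branchCode y l') :
    l = l' ∧ ∀ i < l, x i = y i := by
  obtain ⟨rfl, h2⟩ := Nat.pair_eq_pair.1 h
  refine ⟨rfl, fun i hi => ?_⟩
  exact congrFun (Encodable.encode_injective h2) ⟨i, hi⟩

lemma continuous_branchCode (l : ℕ) : Continuous fun x => branchCode x l :=
  (continuous_of_discreteTopology (f := fun s : Fin l → Bool =>
    Nat.pair l (Encodable.encode s))).comp (continuous_pi fun i => continuous_apply (i : ℕ))

lemma perfect_range_of_continuous_injective {Z : Type*} [TopologicalSpace Z] [T2Space Z]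
    {Ψ : (ℕ → Bool) → Z} (hc : Continuous Ψ) (hi : Function.Injective Ψ) :
    Perfect (range Ψ) := by
  refine ⟨(isCompact_range hc).isClosed, ?_⟩
  rintro _ ⟨x, rfl⟩
  rw [accPt_iff_nhds]
  intro U hU
  have hlim : Filter.Tendsto (fun n => Function.update x n (!x n)) Filter.atTop (nhds x) := by
    rw [tendsto_pi_nhds]
    intro i
    refine tendsto_const_nhds.congr' ?_
    filter_upwards [Filter.eventually_gt_atTop i] with n hn
    rw [Function.update_of_ne hn.ne]
  obtain ⟨n, hn⟩ := (hlim.eventually (hc.continuousAt hU)).exists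
  refine ⟨_, ⟨hn, mem_range_self _⟩, fun heq => ?_⟩
  have := congrFun (hi heq) n
  simp at this

lemma exists_perfect_almostDisjoint_s3 (h : boundingNumber = Cardinal.continuum)
    {G : Set (Set ℕ)} (hG : Cardinal.mk G < Cardinal.continuum) {X D : Set ℕ} (hDX : D ⊆ X)
    (hD : ∀ B ∈ finiteUnions G, (D \ B).Infinite) :
    ∃ 𝒜 : Set (X → Bool), Perfect 𝒜 ∧ 𝒜.Nonempty ∧
      (∀ f ∈ 𝒜, ∀ g ∈ 𝒜, f ≠ g → (decodeOn X f ∩ decodeOn X g).Finite) ∧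
      ∀ f ∈ 𝒜, ∀ B ∈ finiteUnions G, (decodeOn X f \ B).Infinite := by
  classical
  obtain ⟨g, hg⟩ := exists_uniform_bound h (P := {{D}}) hG
    (by simpa using Cardinal.one_lt_aleph0.trans Cardinal.aleph0_lt_continuum)
    (by
      rintro _ rfl
      exact isUniform_singleton D)
    (by
      rintro B hB _ rfl _ rfl
      exact hD B hB)
  set r : ℕ → ℕ := fun n => n + g n + 1 with hr
  set p : ℕ → ℕ := fun k => r^[k] 0 with hp
  have hmono : StrictMono p := strictMono_iterate_of_lt (fun n => by
    simp only [hr]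
    omega) 0
  have hsucc : ∀ k, p (k + 1) = p k + g (p k) + 1 := fun k => by
    simp only [hp, Function.iterate_succ_apply', hr]
  have huniq : ∀ {k a b}, p a ≤ k → k < p (a + 1) → p b ≤ k → k < p (b + 1) → a = b := by
    intro k a b h1 h2 h3 h4
    have h5 : a < b + 1 := hmono.lt_iff_lt.1 (h1.trans_lt h4)
    have h6 : b < a + 1 := hmono.lt_iff_lt.1 (h3.trans_lt h2)
    omega
  set Ψ : (ℕ → Bool) → X → Bool := fun x k => decide ((k : ℕ) ∈ D ∧ ∃ l : Fin (k + 1),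
    p (branchCode x l) ≤ k ∧ (k : ℕ) < p (branchCode x l + 1)) with hΨ
  have hcont : Continuous Ψ := by
    refine continuous_pi fun k => ?_
    exact (continuous_of_discreteTopology (f := fun s : Fin ((k : ℕ) + 1) → ℕ =>
      decide ((k : ℕ) ∈ D ∧ ∃ l, p (s l) ≤ k ∧ (k : ℕ) < p (s l + 1)))).comp
      (continuous_pi fun l : Fin ((k : ℕ) + 1) => continuous_branchCode l)
  have hmem : ∀ x k, k ∈ decodeOn X (Ψ x) ↔
      k ∈ D ∧ ∃ l, p (branchCode x l) ≤ k ∧ k < p (branchCode x l + 1) := by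
    intro x k
    simp only [decodeOn, hΨ, mem_ofPred_eq, decide_eq_true_eq]
    constructor
    · rintro ⟨-, hkD, l, hl⟩
      exact ⟨hkD, l, hl⟩
    · rintro ⟨hkD, l, hl⟩
      have hlk : l ≤ k := (le_branchCode x l).trans ((hmono.id_le _).trans hl.1)
      exact ⟨hDX hkD, hkD, ⟨l, Nat.lt_succ_of_le hlk⟩, hl⟩
  have hinf : ∀ x, ∀ B ∈ finiteUnions G, (decodeOn X (Ψ x) \ B).Infinite := by
    intro x B hB
    obtain ⟨N, hN⟩ := hg B hB {D} rfl
    refine infinite_of_forall_exists_ge fun n => ?_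
    set l := max n N
    have hl : l ≤ p (branchCode x l) := (le_branchCode x l).trans (hmono.id_le _)
    obtain ⟨k, h1, h2, h3⟩ := hN (p (branchCode x l)) ((le_max_right n N).trans hl) D rfl
    refine ⟨k, ((le_max_left n N).trans hl).trans h1, (hmem x k).2 ⟨h3.1, l, h1, ?_⟩, h3.2⟩
    rw [hsucc]
    omega
  have hAD : ∀ x y, x ≠ y → (decodeOn X (Ψ x) ∩ decodeOn X (Ψ y)).Finite := by
    intro x y hxy
    obtain ⟨i, hi⟩ := Function.ne_iff.1 hxy
    refine ((finite_Iic i).biUnion fun l _ => finite_Iio (p (branchCode x l + 1))).subset ?_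
    rintro k ⟨hkx, hky⟩
    obtain ⟨-, l, h1, h2⟩ := (hmem x k).1 hkx
    obtain ⟨-, l', h3, h4⟩ := (hmem y k).1 hky
    obtain ⟨-, h5⟩ := branchCode_eq (huniq h1 h2 h3 h4)
    have hli : l ≤ i := not_lt.1 fun hil => hi (h5 i hil)
    exact mem_biUnion (show l ∈ Iic i from hli) h2
  have hinj : Function.Injective Ψ := by
    intro x y hxy
    by_contra hne
    have h1 := hAD x y hne
    rw [hxy, inter_self] at h1
    have h2 := hinf y ∅ (empty_mem_finiteUnions G)
    rw [sdiff_empty] at h2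
    exact h2 h1
  refine ⟨range Ψ, perfect_range_of_continuous_injective hcont hinj, range_nonempty Ψ, ?_, ?_⟩
  · rintro _ ⟨x, rfl⟩ _ ⟨y, rfl⟩ hne
    exact hAD x y fun hxy => hne (hxy ▸ rfl)
  · rintro _ ⟨x, rfl⟩
    exact hinf x

/-- `C` and `K` settle the pair `(X, φ)` over the ideal generators `G` and the families `P` of sets
to be kept positive. -/
structure Settles (G : Set (Set ℕ)) (P : Set (Set (Set ℕ))) (X : Set ℕ) (φ : ℕ → ℕ)
    (C : Set ℕ) (K : Set (Set ℕ)) : Prop where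
  keepsPositive : KeepsPositive (insert C G) (insert K P)
  isUniform : IsUniform K
  containsIntervals : ContainsIntervals φ C
  subset_or_perfect : X ⊆ C ∨ ∃ 𝒜 : Set (X → Bool), Perfect 𝒜 ∧ 𝒜.Nonempty ∧
    (∀ f ∈ 𝒜, ∀ g ∈ 𝒜, f ≠ g → (decodeOn X f ∩ decodeOn X g).Finite) ∧ K = decodeOn X '' 𝒜

lemma exists_settles (h : boundingNumber = Cardinal.continuum)
    {G : Set (Set ℕ)} {P : Set (Set (Set ℕ))} (hG : Cardinal.mk G < Cardinal.continuum)
    (hP : Cardinal.mk P < Cardinal.continuum) (hu : ∀ K ∈ P, IsUniform K)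
    (hg : KeepsPositive G P) (X : Set ℕ) (φ : ℕ → ℕ) :
    ∃ C K, Settles G P X φ C K := by
  obtain ⟨C, hC, hCP⟩ := exists_containsIntervals_keepsPositive h hG hP hu hg φ
  by_cases hX : KeepsPositive (insert (C ∪ X) G) P
  · obtain ⟨e, he1, he2, he3⟩ := hC
    refine ⟨C ∪ X, ∅, ?_, fun B _ n => ⟨0, fun A hA => hA.elim⟩,
      ⟨e, he1, he2, fun k j h1 h2 => Or.inl (he3 k j h1 h2)⟩, Or.inl subset_union_right⟩
    rintro B hB K (rfl | hK) A hA
    · exact hA.elim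
    · exact hX B hB K hK A hA
  · simp only [KeepsPositive, not_forall, not_infinite] at hX
    obtain ⟨B, hB, K, hK, A, hA, hfin⟩ := hX
    obtain ⟨B', hB', hBB'⟩ := exists_subset_union_of_mem_finiteUnions_insert hB
    have hB'C : B' ∪ C ∈ finiteUnions (insert C G) :=
      union_mem_finiteUnions (finiteUnions_mono (subset_insert C G) hB')
        (mem_finiteUnions_of_mem (mem_insert C G))
    have hD : ∀ E ∈ finiteUnions (insert C G), (((A \ (B' ∪ C)) ∩ X) \ E).Infinite := by
      intro E hE
      refine ((hCP _ (union_mem_finiteUnions hB'C hE) K hK A hA).sdiff hfin).mono ?_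
      rintro x ⟨⟨hxA, hx⟩, hxB⟩
      have hxB' : x ∈ B := by
        by_contra hcon
        exact hxB ⟨hxA, hcon⟩
      have h1 : x ∉ B' ∪ C := fun h' => hx (Or.inl h')
      refine ⟨⟨⟨hxA, h1⟩, ?_⟩, fun h' => hx (Or.inr h')⟩
      rcases hBB' hxB' with h' | h' | h'
      · exact (h1 (Or.inl h')).elim
      · exact (h1 (Or.inr h')).elim
      · exact h'
    have hG' : Cardinal.mk (insert C G : Set (Set ℕ)) < Cardinal.continuum :=
      Cardinal.mk_insert_le.trans_lt (Cardinal.add_lt_of_lt Cardinal.aleph0_le_continuum hG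
        (Cardinal.one_lt_aleph0.trans Cardinal.aleph0_lt_continuum))
    obtain ⟨𝒜, hperf, hne, hAD, hpos⟩ := exists_perfect_almostDisjoint_s3 h hG' inter_subset_right hD
    refine ⟨C, decodeOn X '' 𝒜, ?_, isUniform_image_decodeOn hperf.closed.isCompact, hC,
      Or.inr ⟨𝒜, hperf, hne, hAD, rfl⟩⟩
    rintro E hE K' (rfl | hK') A' hA'
    · obtain ⟨f, hf, rfl⟩ := hA'
      exact hpos f hf E hE
    · exact hCP E hE K' hK' A' hA'

lemma exists_transfinite_choice {ι β : Type*} [LinearOrder ι] [WellFoundedLT ι] [Nonempty β]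
    (R : ι → Set β → β → Prop)
    (hR : ∀ (i : ι) (f : ι → β), (∀ j < i, R j (f '' Iio j) (f j)) → ∃ b, R i (f '' Iio i) b) :
    ∃ f : ι → β, ∀ i, R i (f '' Iio i) (f i) := by
  classical
  let step : ∀ i : ι, (∀ j, j < i → β) → β := fun i u =>
    Classical.epsilon (R i (range fun j : Iio i => u j j.2))
  let f : ι → β := (wellFounded_lt (α := ι)).fix step
  have hf : ∀ i, f i = Classical.epsilon (R i (f '' Iio i)) := by
    intro i
    rw [image_eq_range]
    exact (wellFounded_lt (α := ι)).fix_eq step i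
  refine ⟨f, fun i => ?_⟩
  induction i using WellFoundedLT.induction with
  | ind i ih =>
    rw [hf i]
    exact Classical.epsilon_spec (hR i f ih)

lemma keepsPositive_image {ι : Type*} [LinearOrder ι] (C : ι → Set ℕ) (K : ι → Set (Set ℕ))
    (T : Set ι)
    (hT : ∀ j ∈ T, KeepsPositive (C '' Iic j) (insert {univ} (K '' Iic j))) :
    KeepsPositive (C '' T) (insert {univ} (K '' T)) := by
  rintro B ⟨F, hF, hFT, rfl⟩ L hL A hA
  obtain ⟨t, htT, htfin, rfl⟩ := (exists_subset_image_finite_and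
    (p := fun s => s = F)).1 ⟨F, hFT, hF, rfl⟩
  rcases T.eq_empty_or_nonempty with rfl | ⟨j₀, hj₀⟩
  · obtain rfl := subset_empty_iff.1 htT
    rcases hL with rfl | ⟨j, hj, -⟩
    · obtain rfl : A = univ := hA
      simpa using infinite_univ
    · exact hj.elim
  · obtain ⟨j, hj, hjL⟩ : ∃ j ∈ T, L ∈ insert {univ} (K '' Iic j) := by
      rcases hL with rfl | ⟨j, hj, rfl⟩
      · exact ⟨j₀, hj₀, mem_insert _ _⟩
      · exact ⟨j, hj, Or.inr ⟨j, le_refl j, rfl⟩⟩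
    obtain ⟨m, hm, hmax⟩ := exists_max_image (insert j t) id (htfin.insert j)
      (insert_nonempty j t)
    have hmT : m ∈ T := insert_subset hj htT hm
    refine hT m hmT _ ⟨C '' t, hF, image_mono fun i hi => hmax i (Or.inr hi), rfl⟩ L ?_ A hA
    exact insert_subset_insert (image_mono (Iic_subset_Iic.2 (hmax j (mem_insert j t)))) hjL

lemma Settles.keepsPositive_Iic {ι : Type*} [LinearOrder ι] {f : ι → Set ℕ × Set (Set ℕ)} {i : ι}
    {X : Set ℕ} {φ : ℕ → ℕ} (hf : Settles (Prod.fst '' (f '' Iio i))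
      (insert {univ} (Prod.snd '' (f '' Iio i))) X φ (f i).1 (f i).2) :
    KeepsPositive ((fun j => (f j).1) '' Iic i) (insert {univ} ((fun j => (f j).2) '' Iic i)) := by
  have := hf.keepsPositive
  rw [insert_comm, image_image, image_image] at this
  rwa [← Iio_insert, image_insert_eq, image_insert_eq]

lemma exists_pattern_of_isOpen_of_dense {U : Set (ℕ → Bool)} (hU : IsOpen U) (hd : Dense U)
    (n : ℕ) : ∃ (m : ℕ) (s : ℕ → Bool), ∀ y : ℕ → Bool,
      (∀ k, n ≤ k → k < m → y k = s k) → y ∈ U := by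
  let ext : (Fin n → Bool) → ℕ → Bool := fun a k => if hk : k < n then a ⟨k, hk⟩ else false
  let τ : (ℕ → Bool) → (ℕ → Bool) ≃ₜ (ℕ → Bool) := fun a =>
    { toFun := fun y k => xor (a k) (y k)
      invFun := fun y k => xor (a k) (y k)
      left_inv := fun y => by ext k; simp
      right_inv := fun y => by ext k; simp
      continuous_toFun := continuous_pi fun k =>
        (continuous_of_discreteTopology (f := fun b => xor (a k) b)).comp (continuous_apply k)
      continuous_invFun := continuous_pi fun k =>
        (continuous_of_discreteTopology (f := fun b => xor (a k) b)).comp (continuous_apply k) }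
  have hopen : ∀ a, IsOpen (τ (ext a) ⁻¹' U) := fun a => hU.preimage (τ (ext a)).continuous
  have hdense : Dense (⋂ a, τ (ext a) ⁻¹' U) :=
    dense_iInter_of_isOpen hopen fun a => hd.preimage (τ (ext a)).isOpenMap
  obtain ⟨s, hs⟩ := hdense.nonempty
  have hnhds : (⋂ a, τ (ext a) ⁻¹' U) ∈ nhds s := (isOpen_iInter_of_finite hopen).mem_nhds hs
  rw [nhds_pi, Filter.mem_pi] at hnhds
  obtain ⟨J, hJ, t, ht, hsub⟩ := hnhds
  obtain ⟨m, hm⟩ := hJ.bddAbove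
  refine ⟨m + 1, s, fun y hy => ?_⟩
  let a : Fin n → Bool := fun i => xor (y i) (s i)
  have hmem : τ (ext a) y ∈ ⋂ a, τ (ext a) ⁻¹' U := by
    refine hsub fun k hk => ?_
    have hks : τ (ext a) y k = s k := by
      change xor (ext a k) (y k) = s k
      by_cases hkn : k < n
      · simp only [ext, a, hkn, dif_pos]
        cases y k <;> cases s k <;> rfl
      · simp only [ext, hkn, dif_neg, not_false_eq_true, Bool.false_xor]
        exact hy k (not_lt.1 hkn) (Nat.lt_succ_of_le (hm hk))
    rw [hks]
    exact mem_of_mem_nhds (ht k)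
  have := mem_iInter.1 hmem a
  rwa [mem_preimage, show τ (ext a) (τ (ext a) y) = y from (τ (ext a)).left_inv y] at this

lemma exists_antitone_dense_of_isMeagre {Z : Type*} [TopologicalSpace Z] [BaireSpace Z]
    {M : Set Z} (hM : IsMeagre M) : ∃ V : ℕ → Set Z, Antitone V ∧ (∀ n, IsOpen (V n)) ∧
      (∀ n, Dense (V n)) ∧ Disjoint (⋂ n, V n) M := by
  obtain ⟨S, hSo, hSd, hSc, hSM⟩ := mem_residual_iff.1 hM
  obtain ⟨U, hU⟩ := (hSc.insert univ).exists_eq_range (insert_nonempty _ _)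
  have hUo : ∀ n, IsOpen (U n) := fun n => by
    rcases hU ▸ mem_range_self n with h | h
    · exact h ▸ isOpen_univ
    · exact hSo _ h
  have hUd : ∀ n, Dense (U n) := fun n => by
    rcases hU ▸ mem_range_self n with h | h
    · exact h ▸ dense_univ
    · exact hSd _ h
  refine ⟨fun n => ⋂ k : Fin (n + 1), U k, fun a b hab => ?_,
    fun n => isOpen_iInter_of_finite fun k => hUo k,
    fun n => dense_iInter_of_isOpen (fun k => hUo k) fun k => hUd k, ?_⟩
  · exact fun x hx => mem_iInter.2 fun k =>
      mem_iInter.1 hx ⟨k, k.2.trans_le (Nat.succ_le_succ hab)⟩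
  · refine Set.disjoint_left.2 fun x hx => hSM fun W hW => ?_
    obtain ⟨n, rfl⟩ := hU ▸ mem_insert_of_mem univ hW
    exact mem_iInter.1 (mem_iInter.1 hx n) ⟨n, Nat.lt_succ_self n⟩

lemma not_isMeagre_of_containsIntervals {I : Set (Set ℕ)}
    (hdown : ∀ A B : Set ℕ, A ⊆ B → B ∈ I → A ∈ I)
    (hI : ∀ φ : ℕ → ℕ, ∃ C ∈ I, ContainsIntervals φ C) :
    ¬ IsMeagre {f : ℕ → Bool | {x | f x = true} ∈ I} := by
  classical
  intro hM
  obtain ⟨V, hanti, hVo, hVd, hdisj⟩ := exists_antitone_dense_of_isMeagre hM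
  choose φ s hs using fun n => exists_pattern_of_isOpen_of_dense (hVo n) (hVd n) n
  obtain ⟨C, hC, e, hmono, hsep, heC⟩ := hI φ
  let y : ℕ → Bool := fun j => decide (∃ k, e k ≤ j ∧ j < φ (e k) ∧ s (e k) j = true)
  have huniq : ∀ {j k l}, e k ≤ j → j < φ (e k) → e l ≤ j → j < φ (e l) → ¬ k < l := by
    intro j k l _ h2 h3 _ hkl
    have h5 : e (k + 1) ≤ e l := hmono.monotone hkl
    have h6 := hsep k
    omega
  have hy : ∀ k, y ∈ V (e k) := by
    refine fun k => hs (e k) y fun j h1 h2 => ?_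
    rw [Bool.eq_iff_iff]
    simp only [y, decide_eq_true_eq]
    constructor
    · rintro ⟨l, h3, h4, h5⟩
      obtain rfl : k = l :=
        le_antisymm (not_lt.1 (huniq h3 h4 h1 h2)) (not_lt.1 (huniq h1 h2 h3 h4))
      exact h5
    · exact fun h3 => ⟨k, h1, h2, h3⟩
  refine Set.disjoint_left.1 hdisj (mem_iInter.2 fun n => hanti (hmono.id_le n) (hy n))
    (hdown _ C (fun j hj => ?_) hC)
  obtain ⟨k, h1, h2, -⟩ := of_decide_eq_true hj
  exact heC k j h1 h2

/-- If `𝔟 = 𝔠` then there is a non-meager ideal `I` on `ω` such that on every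
`I`-positive set there is a perfect `(I, Fin)`-almost disjoint family. -/
theorem stmt3 (h : boundingNumber = Cardinal.continuum) :
    ∃ I : Set (Set ℕ), IsIdeal I ∧
      ¬ IsMeagre {f : ℕ → Bool | {x | f x = true} ∈ I} ∧
      ∀ Y : Set ℕ, Y ∉ I → PerfectADFamOn I Y := by
  let ι := Cardinal.continuum.{0}.ord.ToType
  have hlt : ∀ i : ι, Cardinal.mk (Iio i) < Cardinal.continuum := fun i =>
    (Cardinal.mk_Iio_lt i (by simp [ι])).trans_eq (by simp [ι])
  obtain ⟨E⟩ : Nonempty (ι ≃ Set ℕ × (ℕ → ℕ)) := by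
    refine Cardinal.eq.1 ?_
    simp [ι]
  obtain ⟨f, hf⟩ := exists_transfinite_choice
    (fun (i : ι) (S : Set (Set ℕ × Set (Set ℕ))) b =>
      Settles (Prod.fst '' S) (insert {univ} (Prod.snd '' S)) (E i).1 (E i).2 b.1 b.2) (by
    intro i f hf
    have hT := keepsPositive_image (fun j => (f j).1) (fun j => (f j).2) (Iio i) fun j hj =>
      (hf j hj).keepsPositive_Iic
    have hC : Cardinal.mk ((fun j => (f j).1) '' Iio i) < Cardinal.continuum :=
      Cardinal.mk_image_le.trans_lt (hlt i)
    have hK : Cardinal.mk (insert {univ} ((fun j => (f j).2) '' Iio i) : Set (Set (Set ℕ))) <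
        Cardinal.continuum :=
      Cardinal.mk_insert_le.trans_lt (Cardinal.add_lt_of_lt Cardinal.aleph0_le_continuum
        (Cardinal.mk_image_le.trans_lt (hlt i))
        (Cardinal.one_lt_aleph0.trans Cardinal.aleph0_lt_continuum))
    obtain ⟨C, K, hCK⟩ := exists_settles h hC hK (by
      rintro L (rfl | ⟨j, hj, rfl⟩)
      · exact isUniform_singleton univ
      · exact (hf j hj).isUniform) hT (E i).1 (E i).2
    refine ⟨(C, K), ?_⟩
    rwa [image_image, image_image])
  have hpos : ∀ B ∈ finiteUnions (range fun j => (f j).1),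
      ∀ L ∈ insert {univ} (range fun j => (f j).2), ∀ A ∈ L, (A \ B).Infinite := by
    have := keepsPositive_image (fun j => (f j).1) (fun j => (f j).2) univ fun j _ =>
      (hf j).keepsPositive_Iic
    rwa [image_univ, image_univ] at this
  let I : Set (Set ℕ) := {B | ∃ D ∈ finiteUnions (range fun j => (f j).1), (B \ D).Finite}
  have hdown : ∀ A B : Set ℕ, A ⊆ B → B ∈ I → A ∈ I := fun A B hAB ⟨D, hD, hfin⟩ =>
    ⟨D, hD, hfin.subset (sdiff_subset_sdiff_left hAB)⟩
  have hCI : ∀ i, (f i).1 ∈ I := fun i =>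
    ⟨(f i).1, mem_finiteUnions_of_mem (mem_range_self i), by simp⟩
  refine ⟨I, ⟨fun A hA => ⟨∅, empty_mem_finiteUnions _, hA.sdiff⟩, hdown, ?_, ?_⟩,
    not_isMeagre_of_containsIntervals hdown fun φ => ?_, fun Y hY => ?_⟩
  · rintro A B ⟨D, hD, hA⟩ ⟨D', hD', hB⟩
    refine ⟨D ∪ D', union_mem_finiteUnions hD hD', (hA.union hB).subset ?_⟩
    rintro x ⟨hx | hx, hxD⟩
    · exact Or.inl ⟨hx, fun h' => hxD (Or.inl h')⟩
    · exact Or.inr ⟨hx, fun h' => hxD (Or.inr h')⟩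
  · rintro ⟨D, hD, hfin⟩
    exact hpos D hD {univ} (mem_insert _ _) univ rfl hfin
  · have := (hf (E.symm (∅, φ))).containsIntervals
    rw [E.apply_symm_apply] at this
    exact ⟨_, hCI _, this⟩
  · have := (hf (E.symm (Y, id))).subset_or_perfect
    rw [E.apply_symm_apply] at this
    rcases this with hsub | ⟨𝒜, hperf, hne, hAD, hK⟩
    · exact (hY (hdown _ _ hsub (hCI _))).elim
    · refine ⟨𝒜, hperf, hne, fun g hg ⟨D, hD, hfin⟩ => ?_, hAD⟩
      exact hpos D hD _ (mem_insert_of_mem _ (mem_range_self _)) _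
        (hK ▸ mem_image_of_mem _ hg) hfin
end

section
/- Let U be a nonprincipal ultrafilter on ω and let I = {A ⊆ ω : the sequence |A ∩ {0,…,n−1}|/n converges to 0 along U}, i.e. A ∈ I iff for every k ∈ ω the set {n ∈ ω : |A ∩ {0,…,n−1}|/n < 2^{-k}} belongs to U. Then: (1) I is an ideal on ω (it contains all finite sets, is closed under subsets and finite unions, and ω ∉ I); (2) I is nowhere maximal, i.e. for every X ∈ I⁺ there is Y ⊆ X with Y ∉ I and X \ Y ∉ I; and (3) every I-almost disjoint family is countable. -/
open Set

/-- The ideal of sets of `U`-density zero: `A ∈ I` iff for every `k` the set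
`{n : |A ∩ {0,…,n-1}|/n < 2^{-k}}` belongs to `U`. -/
def densityZeroIdeal (U : Ultrafilter ℕ) : Set (Set ℕ) :=
  {A | ∀ k : ℕ, {n : ℕ | ((A ∩ Set.Iio n).ncard : ℝ) / (n : ℝ) < 1 / 2 ^ k} ∈ U}

open Filter Topology

/-- The proportion of `{0,…,n-1}` lying in `A`. -/
noncomputable def initialDensity (A : Set ℕ) (n : ℕ) : ℝ :=
  ((A ∩ Set.Iio n).ncard : ℝ) / (n : ℝ)

lemma initialDensity_nonneg (A : Set ℕ) (n : ℕ) : 0 ≤ initialDensity A n := by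
  unfold initialDensity
  positivity

lemma initialDensity_mono {A B : Set ℕ} (h : A ⊆ B) (n : ℕ) :
    initialDensity A n ≤ initialDensity B n := by
  unfold initialDensity
  gcongr
  exact (Set.finite_Iio n).inter_of_right B

lemma initialDensity_le_one (A : Set ℕ) (n : ℕ) : initialDensity A n ≤ 1 := by
  refine div_le_one_of_le₀ ?_ n.cast_nonneg
  have h := Set.ncard_le_ncard (Set.inter_subset_right (s := A)) (Set.finite_Iio n)
  rw [Set.ncard_Iio_nat] at h
  exact_mod_cast h

lemma initialDensity_union_add_inter (A B : Set ℕ) (n : ℕ) :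
    initialDensity (A ∪ B) n + initialDensity (A ∩ B) n =
      initialDensity A n + initialDensity B n := by
  have h := Set.ncard_union_add_ncard_inter (A ∩ Set.Iio n) (B ∩ Set.Iio n)
    ((Set.finite_Iio n).inter_of_right A) ((Set.finite_Iio n).inter_of_right B)
  rw [← Set.union_inter_distrib_right, ← Set.inter_inter_distrib_right] at h
  unfold initialDensity
  rw [← add_div, ← add_div]
  exact_mod_cast congrArg (fun k : ℕ => (k : ℝ) / n) h

lemma mem_densityZeroIdeal_iff_tendsto (U : Ultrafilter ℕ) (A : Set ℕ) :
    A ∈ densityZeroIdeal U ↔ Tendsto (initialDensity A) U (𝓝 0) := by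
  constructor
  · intro h
    refine tendsto_order.2 ⟨fun a ha => Eventually.of_forall fun n =>
      ha.trans_le (initialDensity_nonneg A n), fun a ha => ?_⟩
    obtain ⟨k, hk⟩ := exists_pow_lt_of_lt_one ha (by norm_num : (1 / 2 : ℝ) < 1)
    rw [one_div_pow] at hk
    filter_upwards [h k] with n hn
    exact lt_trans hn hk
  · intro h k
    exact h.eventually_lt_const (by positivity)

lemma exists_tendsto_initialDensity (U : Ultrafilter ℕ) (A : Set ℕ) :
    ∃ a, Tendsto (initialDensity A) U (𝓝 a) := by
  obtain ⟨a, -, ha⟩ := (isCompact_Icc (a := (0 : ℝ)) (b := 1)).ultrafilter_le_nhds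
    (U.map (initialDensity A)) (le_principal_iff.2 (Ultrafilter.mem_map.2 (univ_mem' fun n =>
      ⟨initialDensity_nonneg A n, initialDensity_le_one A n⟩)))
  exact ⟨a, ha⟩

/-- The density of `A` along the ultrafilter `U`. -/
noncomputable def ultraDensity (U : Ultrafilter ℕ) (A : Set ℕ) : ℝ :=
  (exists_tendsto_initialDensity U A).choose

lemma tendsto_ultraDensity (U : Ultrafilter ℕ) (A : Set ℕ) :
    Tendsto (initialDensity A) U (𝓝 (ultraDensity U A)) :=
  (exists_tendsto_initialDensity U A).choose_spec

lemma mem_densityZeroIdeal_iff (U : Ultrafilter ℕ) (A : Set ℕ) :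
    A ∈ densityZeroIdeal U ↔ ultraDensity U A = 0 := by
  rw [mem_densityZeroIdeal_iff_tendsto]
  exact ⟨tendsto_nhds_unique (tendsto_ultraDensity U A), fun h => h ▸ tendsto_ultraDensity U A⟩

lemma ultraDensity_nonneg (U : Ultrafilter ℕ) (A : Set ℕ) : 0 ≤ ultraDensity U A :=
  ge_of_tendsto' (tendsto_ultraDensity U A) (initialDensity_nonneg A)

lemma ultraDensity_le_one (U : Ultrafilter ℕ) (A : Set ℕ) : ultraDensity U A ≤ 1 :=
  le_of_tendsto' (tendsto_ultraDensity U A) (initialDensity_le_one A)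

lemma ultraDensity_mono (U : Ultrafilter ℕ) {A B : Set ℕ} (h : A ⊆ B) :
    ultraDensity U A ≤ ultraDensity U B :=
  le_of_tendsto_of_tendsto' (tendsto_ultraDensity U A) (tendsto_ultraDensity U B)
    (initialDensity_mono h)

lemma ultraDensity_union_add_inter (U : Ultrafilter ℕ) (A B : Set ℕ) :
    ultraDensity U (A ∪ B) + ultraDensity U (A ∩ B) = ultraDensity U A + ultraDensity U B := by
  refine tendsto_nhds_unique ((tendsto_ultraDensity U _).add (tendsto_ultraDensity U _)) ?_
  simp_rw [initialDensity_union_add_inter]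
  exact (tendsto_ultraDensity U A).add (tendsto_ultraDensity U B)

lemma ultraDensity_pos_iff (U : Ultrafilter ℕ) (A : Set ℕ) :
    0 < ultraDensity U A ↔ A ∉ densityZeroIdeal U := by
  rw [mem_densityZeroIdeal_iff, (ultraDensity_nonneg U A).lt_iff_ne, ne_comm]

lemma mem_densityZeroIdeal_of_subset (U : Ultrafilter ℕ) {A B : Set ℕ} (h : A ⊆ B)
    (hB : B ∈ densityZeroIdeal U) : A ∈ densityZeroIdeal U := by
  rw [mem_densityZeroIdeal_iff] at *
  exact le_antisymm (hB ▸ ultraDensity_mono U h) (ultraDensity_nonneg U A)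

lemma union_mem_densityZeroIdeal (U : Ultrafilter ℕ) {A B : Set ℕ}
    (hA : A ∈ densityZeroIdeal U) (hB : B ∈ densityZeroIdeal U) :
    A ∪ B ∈ densityZeroIdeal U := by
  rw [mem_densityZeroIdeal_iff] at *
  linarith [ultraDensity_union_add_inter U A B, ultraDensity_nonneg U (A ∪ B),
    ultraDensity_nonneg U (A ∩ B)]

lemma ultrafilter_le_atTop {U : Ultrafilter ℕ} (hU : ∀ A ∈ U, (A : Set ℕ).Infinite) :
    (U : Filter ℕ) ≤ atTop := by
  rw [← Nat.cofinite_eq_atTop]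
  intro s hs
  by_contra h
  exact hU sᶜ (Ultrafilter.compl_mem_iff_notMem.2 h) hs

lemma finite_mem_densityZeroIdeal {U : Ultrafilter ℕ} (hU : (U : Filter ℕ) ≤ atTop)
    {A : Set ℕ} (hA : A.Finite) : A ∈ densityZeroIdeal U := by
  rw [mem_densityZeroIdeal_iff_tendsto]
  refine squeeze_zero (initialDensity_nonneg A) (fun n => ?_)
    ((tendsto_const_div_atTop_nhds_zero_nat (A.ncard : ℝ)).mono_left hU)
  unfold initialDensity
  gcongr
  exact Set.inter_subset_left

lemma univ_notMem_densityZeroIdeal {U : Ultrafilter ℕ} (hU : (U : Filter ℕ) ≤ atTop) :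
    (univ : Set ℕ) ∉ densityZeroIdeal U := by
  rw [mem_densityZeroIdeal_iff_tendsto]
  intro h
  have h1 : Tendsto (initialDensity univ) U (𝓝 1) := by
    refine tendsto_const_nhds.congr' ?_
    filter_upwards [hU (eventually_gt_atTop 0)] with n hn
    simp only [initialDensity, Set.univ_inter, Set.ncard_Iio_nat]
    rw [div_self (by positivity)]
  exact zero_ne_one (tendsto_nhds_unique h h1)

open Classical in
lemma ncard_inter_Iio_succ (A : Set ℕ) (n : ℕ) :
    (A ∩ Set.Iio (n + 1)).ncard = (A ∩ Set.Iio n).ncard + if n ∈ A then 1 else 0 := by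
  rw [← Order.succ_eq_add_one, Order.Iio_succ, ← Set.Iio_insert]
  split_ifs with h
  · rw [Set.inter_insert_of_mem h, Set.ncard_insert_of_notMem (by simp)
      ((Set.finite_Iio n).inter_of_right A)]
  · rw [Set.inter_insert_of_notMem h, add_zero]

/-- Every second element of `X`, starting with the least one. -/
def everySecond (X : Set ℕ) : Set ℕ := {x ∈ X | Even (X ∩ Set.Iio x).ncard}

lemma two_mul_ncard_everySecond (X : Set ℕ) (n : ℕ) :
    2 * (everySecond X ∩ Set.Iio n).ncard =
      (X ∩ Set.Iio n).ncard + (X ∩ Set.Iio n).ncard % 2 := by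
  classical
  induction n with
  | zero => simp
  | succ n ih =>
    have h : n ∈ everySecond X ↔ n ∈ X ∧ (X ∩ Set.Iio n).ncard % 2 = 0 := by
      rw [← Nat.even_iff]; rfl
    rw [ncard_inter_Iio_succ, ncard_inter_Iio_succ]
    grind

lemma ncard_diff_everySecond (X : Set ℕ) (n : ℕ) :
    ((X \ everySecond X) ∩ Set.Iio n).ncard + (everySecond X ∩ Set.Iio n).ncard =
      (X ∩ Set.Iio n).ncard := by
  have hs : (X \ everySecond X) ∩ Set.Iio n = (X ∩ Set.Iio n) \ (everySecond X ∩ Set.Iio n) := by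
    grind
  rw [hs]
  exact Set.ncard_sdiff_add_ncard_of_subset (Set.inter_subset_inter_left _ (Set.sep_subset _ _))
    ((Set.finite_Iio n).inter_of_right X)

lemma ultraDensity_le_two_mul {U : Ultrafilter ℕ} (hU : (U : Filter ℕ) ≤ atTop) {X Y : Set ℕ}
    (h : ∀ n, (X ∩ Set.Iio n).ncard ≤ 2 * (Y ∩ Set.Iio n).ncard + 1) :
    ultraDensity U X ≤ 2 * ultraDensity U Y := by
  have ht := ((tendsto_ultraDensity U Y).const_mul 2).add
    ((tendsto_const_div_atTop_nhds_zero_nat (1 : ℝ)).mono_left hU)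
  rw [add_zero] at ht
  refine le_of_tendsto_of_tendsto' (tendsto_ultraDensity U X) ht fun n => ?_
  unfold initialDensity
  rw [← mul_div_assoc, ← add_div]
  gcongr
  exact_mod_cast h n

lemma exists_subset_notMem_densityZeroIdeal {U : Ultrafilter ℕ} (hU : (U : Filter ℕ) ≤ atTop)
    {X : Set ℕ} (hX : X ∉ densityZeroIdeal U) :
    ∃ Y ⊆ X, Y ∉ densityZeroIdeal U ∧ X \ Y ∉ densityZeroIdeal U := by
  simp_rw [← ultraDensity_pos_iff] at *
  have h₁ : ultraDensity U X ≤ 2 * ultraDensity U (everySecond X) :=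
    ultraDensity_le_two_mul hU fun n => by
      have := two_mul_ncard_everySecond X n
      lia
  have h₂ : ultraDensity U X ≤ 2 * ultraDensity U (X \ everySecond X) :=
    ultraDensity_le_two_mul hU fun n => by
      have := two_mul_ncard_everySecond X n
      have := ncard_diff_everySecond X n
      lia
  exact ⟨everySecond X, Set.sep_subset _ _, by linarith, by linarith⟩

lemma biUnion_inter_mem_densityZeroIdeal {U : Ultrafilter ℕ} (hU : (U : Filter ℕ) ≤ atTop)
    {ι : Type*} (s : Finset ι) (f : ι → Set ℕ) (B : Set ℕ)
    (h : ∀ i ∈ s, B ∩ f i ∈ densityZeroIdeal U) :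
    B ∩ ⋃ i ∈ s, f i ∈ densityZeroIdeal U := by
  classical
  induction s using Finset.induction_on with
  | empty => simpa using finite_mem_densityZeroIdeal hU Set.finite_empty
  | insert a s _ ih =>
    rw [Finset.set_biUnion_insert, Set.inter_union_distrib_left]
    exact union_mem_densityZeroIdeal U (h a (Finset.mem_insert_self a s))
      (ih fun i hi => h i (Finset.mem_insert_of_mem hi))

lemma ultraDensity_biUnion {U : Ultrafilter ℕ} (hU : (U : Filter ℕ) ≤ atTop)
    {ι : Type*} (s : Finset ι) (f : ι → Set ℕ)
    (h : ∀ i j, i ≠ j → f i ∩ f j ∈ densityZeroIdeal U) :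
    ultraDensity U (⋃ i ∈ s, f i) = ∑ i ∈ s, ultraDensity U (f i) := by
  classical
  induction s using Finset.induction_on with
  | empty =>
    simpa using (mem_densityZeroIdeal_iff U ∅).1 (finite_mem_densityZeroIdeal hU Set.finite_empty)
  | insert a s ha ih =>
    have h0 := (mem_densityZeroIdeal_iff U _).1 (biUnion_inter_mem_densityZeroIdeal hU s f (f a)
      fun i hi => h a i fun e => ha (e ▸ hi))
    have h1 := ultraDensity_union_add_inter U (f a) (⋃ i ∈ s, f i)
    rw [h0, add_zero, ih] at h1
    rw [Finset.set_biUnion_insert, h1, Finset.sum_insert ha]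

lemma countable_of_inter_mem_densityZeroIdeal {U : Ultrafilter ℕ} (hU : (U : Filter ℕ) ≤ atTop)
    {𝒜 : Set (Set ℕ)} (hpos : ∀ A ∈ 𝒜, A ∉ densityZeroIdeal U)
    (hdisj : ∀ A ∈ 𝒜, ∀ B ∈ 𝒜, A ≠ B → A ∩ B ∈ densityZeroIdeal U) : 𝒜.Countable := by
  have hs : Summable fun A : 𝒜 => ultraDensity U A :=
    summable_of_sum_le (fun A => ultraDensity_nonneg U A) (c := 1) fun s => by
      rw [← ultraDensity_biUnion hU s (fun A : 𝒜 => (A : Set ℕ)) fun A B hAB =>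
        hdisj A A.2 B B.2 (Subtype.coe_ne_coe.2 hAB)]
      exact ultraDensity_le_one U _
  have hsupp : (Function.support fun A : 𝒜 => ultraDensity U A) = univ :=
    Set.eq_univ_of_forall fun A => ((ultraDensity_pos_iff U A).2 (hpos A A.2)).ne'
  exact Set.countable_coe_iff.1 (Set.countable_univ_iff.1 (hsupp ▸ hs.countable_support))

/-- For a nonprincipal ultrafilter `U`, the ideal of sets whose density converges to `0`
along `U` is an ideal which is nowhere maximal, yet all of its almost disjoint families
are countable. -/
theorem stmt4 (U : Ultrafilter ℕ) (hU : ∀ A ∈ U, (A : Set ℕ).Infinite) :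
    IsIdeal (densityZeroIdeal U) ∧
    (∀ X : Set ℕ, X ∉ densityZeroIdeal U →
      ∃ Y ⊆ X, Y ∉ densityZeroIdeal U ∧ X \ Y ∉ densityZeroIdeal U) ∧
    (∀ 𝒜 : Set (Set ℕ), 𝒜.Nonempty → (∀ A ∈ 𝒜, A ∉ densityZeroIdeal U) →
      (∀ A ∈ 𝒜, ∀ B ∈ 𝒜, A ≠ B → A ∩ B ∈ densityZeroIdeal U) → 𝒜.Countable) := by
  have hU' := ultrafilter_le_atTop hU
  exact ⟨⟨fun _ => finite_mem_densityZeroIdeal hU', fun _ _ => mem_densityZeroIdeal_of_subset U,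
      fun _ _ => union_mem_densityZeroIdeal U, univ_notMem_densityZeroIdeal hU'⟩,
    fun _ => exists_subset_notMem_densityZeroIdeal hU',
    fun _ _ => countable_of_inter_mem_densityZeroIdeal hU'⟩
end

section
/- Assume MA_κ. Let I be an everywhere meager ideal on ω and let H ⊆ I⁺ be a family of I-positive sets with |H| ≤ κ. Then H has an (I,Fin)-almost disjoint refinement: a family {A_H : H ∈ H} such that A_H ⊆ H and A_H ∈ I⁺ for every H ∈ H, and A_{H₀} ∩ A_{H₁} is finite for all distinct H₀, H₁ ∈ H. -/
open Set

/-- Martin's Axiom for `κ` dense sets: for every nonempty ccc partial order `P` and every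
family of at most `κ` many dense subsets of `P`, there is a filter on `P` meeting all of
them. -/
def MartinAxiom (κ : Cardinal) : Prop :=
  ∀ (P : Type) [PartialOrder P], Nonempty P →
    (∀ A : Set P, (∀ p ∈ A, ∀ q ∈ A, p ≠ q → ¬ ∃ r, r ≤ p ∧ r ≤ q) → A.Countable) →
    ∀ 𝒟 : Set (Set P), Cardinal.mk 𝒟 ≤ κ →
      (∀ D ∈ 𝒟, ∀ p : P, ∃ q ∈ D, q ≤ p) →
      ∃ G : Set P, G.Nonempty ∧
        (∀ p ∈ G, ∀ q, p ≤ q → q ∈ G) ∧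
        (∀ p ∈ G, ∀ q ∈ G, ∃ r ∈ G, r ≤ p ∧ r ≤ q) ∧
        ∀ D ∈ 𝒟, (G ∩ D).Nonempty

/-- A finite approximation to an almost disjoint refinement: to each of the finitely many sets
`X ∈ F` it assigns a subset `a X` of `X ∩ {0, …, n - 1}`. -/
structure RefinementCondition where
  F : Finset (Set ℕ)
  n : ℕ
  a : Set ℕ → Finset ℕ
  mem_F : ∀ {X i}, i ∈ a X → X ∈ F
  mem_self : ∀ {X i}, i ∈ a X → i ∈ X
  lt_n : ∀ {X i}, i ∈ a X → i < n

namespace RefinementCondition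

/-- `q ≤ p` if `q` end-extends the sets of `p` and keeps them disjoint above `p.n`. -/
instance : PartialOrder RefinementCondition where
  le q p := p.F ⊆ q.F ∧ p.n ≤ q.n ∧ (∀ X ∈ p.F, ∀ i < p.n, i ∈ q.a X ↔ i ∈ p.a X) ∧
    ∀ X ∈ p.F, ∀ Y ∈ p.F, X ≠ Y → ∀ i, i ∈ q.a X → i ∈ q.a Y → i < p.n
  le_refl p := ⟨subset_rfl, le_rfl, fun _ _ _ _ => Iff.rfl, fun _ _ _ _ _ _ h _ => p.lt_n h⟩
  le_trans r q p := by
    rintro ⟨hF, hn, ha, hd⟩ ⟨hF', hn', ha', hd'⟩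
    refine ⟨hF'.trans hF, hn'.trans hn, fun X hX i hi => ?_, fun X hX Y hY hXY i hiX hiY => ?_⟩
    · rw [ha X (hF' hX) i (hi.trans_le hn'), ha' X hX i hi]
    · have hi := hd X (hF' hX) Y (hF' hY) hXY i hiX hiY
      exact hd' X hX Y hY hXY i ((ha X (hF' hX) i hi).1 hiX) ((ha Y (hF' hY) i hi).1 hiY)
  le_antisymm p q := by
    rintro ⟨hF, hn, ha, -⟩ ⟨hF', hn', ha', -⟩
    have hFF : p.F = q.F := hF'.antisymm hF
    have hnn : p.n = q.n := hn'.antisymm hn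
    have haa : p.a = q.a := by
      ext X i
      constructor
      · intro h
        exact (ha X (hFF ▸ p.mem_F h) i (hnn ▸ p.lt_n h)).1 h
      · intro h
        exact (ha' X (hFF ▸ q.mem_F h) i (hnn ▸ q.lt_n h)).1 h
    cases p
    cases q
    simp_all

theorem le_def {q p : RefinementCondition} : q ≤ p ↔
    p.F ⊆ q.F ∧ p.n ≤ q.n ∧ (∀ X ∈ p.F, ∀ i < p.n, i ∈ q.a X ↔ i ∈ p.a X) ∧
    ∀ X ∈ p.F, ∀ Y ∈ p.F, X ≠ Y → ∀ i, i ∈ q.a X → i ∈ q.a Y → i < p.n :=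
  Iff.rfl

theorem a_subset_of_le {q p : RefinementCondition} (h : q ≤ p) {X : Set ℕ} {i : ℕ}
    (hi : i ∈ p.a X) : i ∈ q.a X :=
  (h.2.2.1 X (p.mem_F hi) i (p.lt_n hi)).2 hi

instance : Nonempty RefinementCondition :=
  ⟨⟨∅, 0, fun _ => ∅, by simp, by simp, by simp⟩⟩

open Classical in
/-- The trace of a set of natural numbers below `k`. -/
noncomputable def trace (k : ℕ) (X : Set ℕ) : Finset ℕ :=
  (Finset.range k).filter (· ∈ X)

theorem exists_injOn_trace (F : Finset (Set ℕ)) : ∃ k, Set.InjOn (trace k) (F : Set (Set ℕ)) := by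
  classical
  have key : ∀ P : Set ℕ × Set ℕ, ∃ k, ∀ m ≥ k, trace m P.1 = trace m P.2 → P.1 = P.2 := by
    rintro ⟨X, Y⟩
    by_cases h : X = Y
    · exact ⟨0, fun _ _ _ => h⟩
    obtain ⟨i, hi⟩ : ∃ i, ¬(i ∈ X ↔ i ∈ Y) := by
      by_contra! hc
      exact h (Set.ext hc)
    refine ⟨i + 1, fun m hm ht => absurd ?_ hi⟩
    have := Finset.ext_iff.1 ht i
    simp only [trace, Finset.mem_filter, Finset.mem_range] at this
    have him : i < m := hm
    simpa [him] using this
  choose k hk using key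
  refine ⟨(F ×ˢ F).sup k, fun X hX Y hY h => hk (X, Y) _ ?_ h⟩
  exact Finset.le_sup (f := k) (Finset.mk_mem_product hX hY)

/-- Conditions agreeing on the intersection of their domains are compatible. -/
theorem exists_le_le {p q : RefinementCondition} (hn : p.n = q.n)
    (h : ∀ X ∈ p.F, X ∈ q.F → p.a X = q.a X) : ∃ r, r ≤ p ∧ r ≤ q := by
  classical
  have hp : ∀ X ∈ p.F, p.a X ∪ q.a X = p.a X := fun X hX => by
    refine Finset.union_eq_left.2 fun i hi => ?_
    rwa [h X hX (q.mem_F hi)]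
  have hq : ∀ X ∈ q.F, p.a X ∪ q.a X = q.a X := fun X hX => by
    refine Finset.union_eq_right.2 fun i hi => ?_
    rwa [← h X (p.mem_F hi) hX]
  refine ⟨⟨p.F ∪ q.F, p.n, fun X => p.a X ∪ q.a X, fun {X i} hi => ?_, fun {X i} hi => ?_,
    fun {X i} hi => ?_⟩, ?_, ?_⟩
  · exact Finset.mem_union.2 ((Finset.mem_union.1 hi).imp p.mem_F q.mem_F)
  · exact (Finset.mem_union.1 hi).elim p.mem_self q.mem_self
  · exact (Finset.mem_union.1 hi).elim p.lt_n fun hi => hn ▸ q.lt_n hi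
  · refine le_def.2 ⟨Finset.subset_union_left, le_rfl, fun X hX i _ => ?_,
      fun X hX Y _ _ i hi _ => ?_⟩
    · simp only [hp X hX]
    · simp only [hp X hX] at hi
      exact p.lt_n hi
  · refine le_def.2 ⟨Finset.subset_union_right, hn.ge, fun X hX i _ => ?_,
      fun X hX Y _ _ i hi _ => ?_⟩
    · simp only [hq X hX]
    · simp only [hq X hX] at hi
      exact q.lt_n hi

theorem countable_of_antichain (A : Set RefinementCondition)
    (hA : ∀ p ∈ A, ∀ q ∈ A, p ≠ q → ¬ ∃ r, r ≤ p ∧ r ≤ q) : A.Countable := by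
  classical
  choose k hk using exists_injOn_trace
  let t : RefinementCondition → ℕ × ℕ × Finset (Finset ℕ × Finset ℕ) := fun p =>
    (p.n, k p.F, p.F.image fun X => (trace (k p.F) X, p.a X))
  refine Set.MapsTo.countable_of_injOn (f := t) (t := univ) (fun _ _ => mem_univ _) ?_
    (Set.to_countable _)
  intro p hp q hq hpq
  by_contra hne
  simp only [t, Prod.mk.injEq] at hpq
  obtain ⟨hn, hkk, himg⟩ := hpq
  refine hA p hp q hq hne (exists_le_le hn fun X hXp hXq => ?_)
  have hX := Finset.mem_image_of_mem (fun X => (trace (k p.F) X, p.a X)) hXp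
  rw [himg] at hX
  obtain ⟨Y, hY, hYX⟩ := Finset.mem_image.1 hX
  simp only [Prod.mk.injEq] at hYX
  rw [hkk] at hYX
  rw [← hYX.2, hk q.F hY hXq hYX.1]

/-- The conditions deciding that the set assigned to `X` has its characteristic function
in `U`. -/
def deciding (X : Set ℕ) (U : Set (X → Bool)) : Set RefinementCondition :=
  {p | X ∈ p.F ∧ ∀ f : X → Bool, (∀ i : X, (i : ℕ) < p.n → (f i = true ↔ (i : ℕ) ∈ p.a X)) → f ∈ U}

theorem exists_mem_deciding_le {X : Set ℕ} {U : Set (X → Bool)} (hU : IsOpen U) (hd : Dense U)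
    (p : RefinementCondition) : ∃ q ∈ deciding X U, q ≤ p := by
  classical
  let C : Set (X → Bool) :=
    ⋂ i ∈ {i : X | (i : ℕ) < p.n}, {f | f i = decide ((i : ℕ) ∈ p.a X)}
  have hC : IsOpen C := by
    refine Set.Finite.isOpen_biInter ?_ fun i _ => ?_
    · exact (Set.finite_Iio p.n).preimage Subtype.val_injective.injOn
    · exact isOpen_discrete {decide ((i : ℕ) ∈ p.a X)} |>.preimage (continuous_apply (A := fun _ : X => Bool) i)
  obtain ⟨g, hgC, hgU⟩ := hd.inter_open_nonempty C hC
    ⟨fun i => decide ((i : ℕ) ∈ p.a X), by simp [C]⟩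
  have hg : ∀ i : X, (i : ℕ) < p.n → (g i = true ↔ (i : ℕ) ∈ p.a X) := by
    intro i hi
    have : g i = decide ((i : ℕ) ∈ p.a X) := Set.mem_iInter₂.1 hgC i hi
    simp [this]
  obtain ⟨J, u, hu, hJ⟩ := isOpen_pi_iff.1 hU g hgU
  let m := max p.n (J.sup fun i => (i : ℕ) + 1)
  have hJm : ∀ i ∈ J, (i : ℕ) < m := fun i hi =>
    (Finset.le_sup (f := fun i : X => (i : ℕ) + 1) hi).trans (le_max_right _ _)
  let b : Finset ℕ := (Finset.range m).filter fun i => ∃ h : i ∈ X, g ⟨i, h⟩ = true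
  have hb : ∀ i, i ∈ b ↔ i < m ∧ ∃ h : i ∈ X, g ⟨i, h⟩ = true := by simp [b]
  let a : Set ℕ → Finset ℕ := Function.update p.a X b
  have haX : a X = b := Function.update_self ..
  have ha : ∀ Y, Y ≠ X → a Y = p.a Y := fun Y hY => Function.update_of_ne hY ..
  refine ⟨⟨insert X p.F, m, a, fun {Y i} hi => ?_, fun {Y i} hi => ?_, fun {Y i} hi => ?_⟩,
    ⟨Finset.mem_insert_self _ _, fun f hf => hJ fun i hi => ?_⟩,
    le_def.2 ⟨Finset.subset_insert _ _, le_max_left _ _, fun Y hY i hi => ?_,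
      fun Y hY Z hZ hYZ i hiY hiZ => ?_⟩⟩
  · by_cases hY : Y = X
    · simp [hY]
    · rw [ha Y hY] at hi
      exact Finset.mem_insert_of_mem (p.mem_F hi)
  · by_cases hY : Y = X
    · subst hY
      rw [haX, hb] at hi
      exact hi.2.1
    · rw [ha Y hY] at hi
      exact p.mem_self hi
  · by_cases hY : Y = X
    · subst hY
      rw [haX, hb] at hi
      exact hi.1
    · rw [ha Y hY] at hi
      exact (p.lt_n hi).trans_le (le_max_left _ _)
  · have hfi := hf i (hJm i hi)
    simp only [haX, hb, hJm i hi, true_and, Subtype.coe_eta, Subtype.coe_prop, exists_true_left]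
      at hfi
    rw [Bool.eq_iff_iff.2 hfi]
    exact (hu i hi).2
  · by_cases hYX : Y = X
    · subst hYX
      simp only [haX, hb]
      constructor
      · rintro ⟨-, h, hgi⟩
        exact (hg ⟨i, h⟩ hi).1 hgi
      · intro h
        exact ⟨hi.trans_le (le_max_left _ _), p.mem_self h, (hg ⟨i, p.mem_self h⟩ hi).2 h⟩
    · simp only [ha Y hYX]
  · by_cases hYX : Y = X
    · simp only [ha Z fun h => hYZ (hYX.trans h.symm)] at hiZ
      exact p.lt_n hiZ
    · simp only [ha Y hYX] at hiY
      exact p.lt_n hiY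

end RefinementCondition

/-- A countable family of dense sets is met by a filter. -/
theorem exists_filter_of_countable {P : Type*} [PartialOrder P] [Nonempty P] {𝒟 : Set (Set P)}
    (hc : 𝒟.Countable) (hd : ∀ D ∈ 𝒟, ∀ p : P, ∃ q ∈ D, q ≤ p) :
    ∃ G : Set P, G.Nonempty ∧
      (∀ p ∈ G, ∀ q, p ≤ q → q ∈ G) ∧
      (∀ p ∈ G, ∀ q ∈ G, ∃ r ∈ G, r ≤ p ∧ r ≤ q) ∧
      ∀ D ∈ 𝒟, (G ∩ D).Nonempty := by
  have := hc.toEncodable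
  let C : 𝒟 → Order.Cofinal Pᵒᵈ := fun D => ⟨OrderDual.ofDual ⁻¹' D.1, fun p => hd D.1 D.2 p⟩
  let J := Order.idealOfCofinals (OrderDual.toDual (Classical.arbitrary P)) C
  refine ⟨OrderDual.toDual ⁻¹' (J : Set Pᵒᵈ), J.nonempty, fun p hp q hpq => J.lower hpq hp,
    fun p hp q hq => J.directed p hp q hq, fun D hD => ?_⟩
  obtain ⟨x, hx, hxJ⟩ := Order.cofinal_meets_idealOfCofinals
    (OrderDual.toDual (Classical.arbitrary P)) C ⟨D, hD⟩
  exact ⟨x, hxJ, hx⟩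

theorem MartinAxiom.max_aleph0 {κ : Cardinal} (h : MartinAxiom κ) :
    MartinAxiom (max κ Cardinal.aleph0) := by
  rcases le_total κ Cardinal.aleph0 with hκ | hκ
  · intro P _ _ _ 𝒟 hcard hd
    rw [max_eq_right hκ] at hcard
    exact exists_filter_of_countable (Cardinal.le_aleph0_iff_set_countable.1 hcard) hd
  · rwa [max_eq_left hκ]

theorem IsMeagre.exists_seq_isOpen_dense {X : Type*} [TopologicalSpace X] {s : Set X}
    (hs : IsMeagre s) :
    ∃ U : ℕ → Set X, (∀ k, IsOpen (U k)) ∧ (∀ k, Dense (U k)) ∧ ⋂ k, U k ⊆ sᶜ := by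
  obtain ⟨S, hSo, hSd, hSc, hS⟩ := mem_residual_iff.1 hs
  obtain ⟨U, hU⟩ := (hSc.insert univ).exists_eq_range (insert_nonempty _ _)
  have hmem : ∀ k, U k ∈ insert univ S := fun k => hU ▸ mem_range_self k
  refine ⟨U, fun k => ?_, fun k => ?_, fun x hx => hS fun t ht => ?_⟩
  · rcases hmem k with h | h
    · exact h ▸ isOpen_univ
    · exact hSo _ h
  · rcases hmem k with h | h
    · exact h ▸ dense_univ
    · exact hSd _ h
  · obtain ⟨k, rfl⟩ : t ∈ range U := hU ▸ mem_insert_of_mem _ ht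
    exact mem_iInter.1 hx k

/-- Under `MA_κ`, if `I` is an everywhere meager ideal on `ω` and `H ⊆ I⁺` has size at
most `κ`, then `H` has an `(I, Fin)`-almost disjoint refinement. -/
theorem stmt5 (κ : Cardinal) (hMA : MartinAxiom κ)
    (I : Set (Set ℕ)) (hI : IsIdeal I)
    (hEM : ∀ Y : Set ℕ, Y ∉ I → MeagerOn I Y)
    (H : Set (Set ℕ)) (hH : ∀ A ∈ H, A ∉ I)
    (hcard : Cardinal.mk H ≤ κ) :
    ∃ A : Set ℕ → Set ℕ, ∀ H₀ ∈ H, A H₀ ⊆ H₀ ∧ A H₀ ∉ I ∧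
      ∀ H₁ ∈ H, H₀ ≠ H₁ → (A H₀ ∩ A H₁).Finite := by
  classical
  have hmeager : ∀ X : H, ∃ U : ℕ → Set (X.1 → Bool), (∀ k, IsOpen (U k)) ∧
      (∀ k, Dense (U k)) ∧ ⋂ k, U k ⊆ {f | decodeOn X.1 f ∈ I}ᶜ := fun X =>
    IsMeagre.exists_seq_isOpen_dense (hEM X.1 (hH X.1 X.2))
  choose U hUo hUd hUI using hmeager
  let D : H × ℕ → Set RefinementCondition := fun x =>
    RefinementCondition.deciding x.1.1 (U x.1 x.2)
  have hD : Cardinal.mk (range D) ≤ max κ Cardinal.aleph0 := by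
    refine Cardinal.mk_range_le.trans ?_
    rw [Cardinal.mk_prod, Cardinal.lift_id, Cardinal.lift_id, Cardinal.mk_nat]
    exact (Cardinal.mul_le_max_of_aleph0_le_right le_rfl).trans (max_le_max_right _ hcard)
  obtain ⟨G, -, -, hdir, hG⟩ := hMA.max_aleph0 RefinementCondition inferInstance
    RefinementCondition.countable_of_antichain (range D) hD (by
      rintro _ ⟨x, rfl⟩ p
      exact RefinementCondition.exists_mem_deciding_le (hUo _ _) (hUd _ _) p)
  have hdec : ∀ X (hX : X ∈ H) (k : ℕ), ∃ p ∈ G,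
      p ∈ RefinementCondition.deciding X (U ⟨X, hX⟩ k) := fun X hX k =>
    hG _ ⟨(⟨X, hX⟩, k), rfl⟩
  refine ⟨fun X => {i | ∃ p ∈ G, i ∈ p.a X}, fun X hX => ⟨?_, fun hXI => ?_, fun Y hY hXY => ?_⟩⟩
  · rintro i ⟨p, -, hi⟩
    exact p.mem_self hi
  · let f : X → Bool := fun i => decide (∃ p ∈ G, (i : ℕ) ∈ p.a X)
    have hf : decodeOn X f = {i | ∃ p ∈ G, i ∈ p.a X} := by
      ext i
      simp only [decodeOn, f, decide_eq_true_eq, mem_ofPred_eq]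
      exact ⟨fun h => h.2, fun h => ⟨h.elim fun p hp => p.mem_self hp.2, h⟩⟩
    refine hUI ⟨X, hX⟩ (mem_iInter.2 fun k => ?_) (show decodeOn X f ∈ I from hf ▸ hXI)
    obtain ⟨p, hpG, hXp, hp⟩ := hdec X hX k
    refine hp f fun i hi => ?_
    simp only [f, decide_eq_true_eq]
    refine ⟨?_, fun h => ⟨p, hpG, h⟩⟩
    rintro ⟨q, hqG, hq⟩
    obtain ⟨r, -, hrp, hrq⟩ := hdir p hpG q hqG
    exact (hrp.2.2.1 X hXp i hi).1 (RefinementCondition.a_subset_of_le hrq hq)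
  · obtain ⟨p, hpG, hXp, -⟩ := hdec X hX 0
    obtain ⟨q, hqG, hYq, -⟩ := hdec Y hY 0
    obtain ⟨r, hrG, hrp, hrq⟩ := hdir p hpG q hqG
    refine (finite_Iio r.n).subset ?_
    rintro i ⟨⟨s, hsG, hs⟩, t, htG, ht⟩
    obtain ⟨u, huG, hus, hut⟩ := hdir s hsG t htG
    obtain ⟨v, -, hvr, hvu⟩ := hdir r hrG u huG
    exact hvr.2.2.2 X (hrp.1 hXp) Y (hrq.1 hYq) hXY i
      (RefinementCondition.a_subset_of_le (hvu.trans hus) hs)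
      (RefinementCondition.a_subset_of_le (hvu.trans hut) ht)
end

section
/- Let I be a tall ideal on ω. Define add*(I) as the least cardinality of a family X ⊆ I for which there is no A ∈ I with X ⊆* A (i.e. X \ A finite) for every X ∈ X; define F(I) as the least cardinality of a family H ⊆ I⁺ having no I-almost disjoint refinement; and define F*(I) as the least cardinality of a family H ⊆ I⁺ having no (I,Fin)-almost disjoint refinement. Then: (1) if add*(I) < F(I) then add*(I) < F*(I); and (2) if add*(I) = F(I) then F(I) = F*(I). -/
open Set

/-- `I` is tall: every infinite subset of `ω` contains an infinite element of `I`. -/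
def Tall (I : Set (Set ℕ)) : Prop :=
  ∀ X : Set ℕ, X.Infinite → ∃ A ⊆ X, A.Infinite ∧ A ∈ I

/-- `H` has an `I`-almost disjoint refinement. -/
def HasADR (I : Set (Set ℕ)) (H : Set (Set ℕ)) : Prop :=
  ∃ A : Set ℕ → Set ℕ, ∀ H₀ ∈ H, A H₀ ⊆ H₀ ∧ A H₀ ∉ I ∧
    ∀ H₁ ∈ H, H₀ ≠ H₁ → A H₀ ∩ A H₁ ∈ I

/-- `H` has an `(I, Fin)`-almost disjoint refinement. -/
def HasFinADR (I : Set (Set ℕ)) (H : Set (Set ℕ)) : Prop :=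
  ∃ A : Set ℕ → Set ℕ, ∀ H₀ ∈ H, A H₀ ⊆ H₀ ∧ A H₀ ∉ I ∧
    ∀ H₁ ∈ H, H₀ ≠ H₁ → (A H₀ ∩ A H₁).Finite

/-- The star-additivity `add*(I)`: the least size of a family `𝒳 ⊆ I` with no
pseudounion in `I`. -/
noncomputable def addStar (I : Set (Set ℕ)) : Cardinal :=
  sInf {c | ∃ 𝒳 : Set (Set ℕ), 𝒳 ⊆ I ∧ Cardinal.mk 𝒳 = c ∧
    ¬ ∃ A ∈ I, ∀ X ∈ 𝒳, (X \ A).Finite}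

/-- The Fodor number `F(I)`: the least size of a family `H ⊆ I⁺` with no `I`-ADR. -/
noncomputable def fodorNumber (I : Set (Set ℕ)) : Cardinal :=
  sInf {c | ∃ H : Set (Set ℕ), (∀ A ∈ H, A ∉ I) ∧ Cardinal.mk H = c ∧ ¬ HasADR I H}

/-- The star-Fodor number `F*(I)`: the least size of a family `H ⊆ I⁺` with no
`(I, Fin)`-ADR. -/
noncomputable def fodorStarNumber (I : Set (Set ℕ)) : Cardinal :=
  sInf {c | ∃ H : Set (Set ℕ), (∀ A ∈ H, A ∉ I) ∧ Cardinal.mk H = c ∧ ¬ HasFinADR I H}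

theorem exists_pseudounion_of_lt_addStar {I 𝒳 : Set (Set ℕ)} (h𝒳 : 𝒳 ⊆ I)
    (hlt : Cardinal.mk 𝒳 < addStar I) : ∃ A ∈ I, ∀ X ∈ 𝒳, (X \ A).Finite := by
  by_contra h
  exact notMem_of_lt_csInf' hlt ⟨𝒳, h𝒳, rfl, h⟩

theorem hasADR_of_lt_fodorNumber {I H : Set (Set ℕ)} (hH : ∀ A ∈ H, A ∉ I)
    (hlt : Cardinal.mk H < fodorNumber I) : HasADR I H := by
  by_contra h
  exact notMem_of_lt_csInf' hlt ⟨H, hH, rfl, h⟩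

theorem HasFinADR.hasADR {I H : Set (Set ℕ)} (hfin : ∀ A : Set ℕ, A.Finite → A ∈ I)
    (h : HasFinADR I H) : HasADR I H := by
  obtain ⟨A, hA⟩ := h
  exact ⟨A, fun K hK ↦ ⟨(hA K hK).1, (hA K hK).2.1,
    fun L hL hne ↦ hfin _ ((hA K hK).2.2 L hL hne)⟩⟩

/-- An `I`-almost disjoint refinement of a family of size at most `addStar I` can be thinned out
to an `(I, Fin)`-almost disjoint one: well-order the family in its minimal order type and remove
from each set a pseudounion of its intersections with the earlier ones. -/
theorem HasADR.hasFinADR_of_le_addStar {I H : Set (Set ℕ)} (hI : IsIdeal I) (h : HasADR I H)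
    (hle : Cardinal.mk H ≤ addStar I) : HasFinADR I H := by
  classical
  obtain ⟨A, hA⟩ := h
  obtain ⟨r, _, hr⟩ := Cardinal.exists_ord_eq H
  have key (K : H) : ∃ C ∈ I, ∀ L : H, r L K → ((A L ∩ A K) \ C).Finite := by
    obtain ⟨C, hC, hfin⟩ := exists_pseudounion_of_lt_addStar (I := I)
      (𝒳 := range fun L : {L // r L K} ↦ A L.1 ∩ A K) (by
        rintro _ ⟨⟨L, hL⟩, rfl⟩
        exact (hA L L.2).2.2 K K.2 fun h ↦ irrefl K (Subtype.ext h ▸ hL))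
      (Cardinal.mk_range_le.trans_lt ((Cardinal.card_typein_lt K hr).trans_le hle))
    exact ⟨C, hC, fun L hL ↦ hfin _ ⟨⟨L, hL⟩, rfl⟩⟩
  choose C hCI hC using key
  refine ⟨fun K ↦ if hK : K ∈ H then A K \ C ⟨K, hK⟩ else ∅, fun K hK ↦ ?_⟩
  simp only [hK, dif_pos]
  refine ⟨sdiff_subset.trans (hA K hK).1, fun hmem ↦ (hA K hK).2.1 ?_, fun L hL hne ↦ ?_⟩
  · refine hI.2.1 _ _ ?_ (hI.2.2.1 _ _ hmem (hCI ⟨K, hK⟩))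
    rw [sdiff_union_self]
    exact subset_union_left
  · simp only [hL, dif_pos]
    rcases trichotomous_of r (⟨K, hK⟩ : H) ⟨L, hL⟩ with hlt | heq | hlt
    · exact (hC _ _ hlt).subset fun x hx ↦ ⟨⟨hx.1.1, hx.2.1⟩, hx.2.2⟩
    · exact absurd (congrArg Subtype.val heq) hne
    · exact (hC _ _ hlt).subset fun x hx ↦ ⟨⟨hx.2.1, hx.1.1⟩, hx.1.2⟩

theorem not_hasADR_compl {I : Set (Set ℕ)} (hI : IsIdeal I) : ¬ HasADR I Iᶜ := by
  rintro ⟨A, hA⟩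
  have hfix (K : Set ℕ) (hK : K ∉ I) : A K = K := by
    by_contra hne
    obtain ⟨-, hpos, had⟩ := hA K hK
    obtain ⟨hsub, hpos', -⟩ := hA (A K) hpos
    have := had (A K) hpos (Ne.symm hne)
    rw [inter_eq_right.2 hsub] at this
    exact hpos' this
  have hpos : ({0}ᶜ : Set ℕ) ∉ I := fun h ↦ hI.2.2.2 <| by
    rw [← union_compl_self ({0} : Set ℕ)]
    exact hI.2.2.1 _ _ (hI.1 _ (finite_singleton 0)) h
  have := (hA univ hI.2.2.2).2.2 _ hpos fun h ↦ by simpa using h.subset (mem_univ 0)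
  rw [hfix _ hI.2.2.2, hfix _ hpos, univ_inter] at this
  exact hpos this

theorem exists_mk_eq_fodorNumber {I : Set (Set ℕ)} (hI : IsIdeal I) :
    ∃ H : Set (Set ℕ), (∀ A ∈ H, A ∉ I) ∧ Cardinal.mk H = fodorNumber I ∧ ¬ HasADR I H :=
  csInf_mem (s := {c | ∃ H : Set (Set ℕ), (∀ A ∈ H, A ∉ I) ∧ Cardinal.mk H = c ∧ ¬ HasADR I H})
    ⟨_, Iᶜ, fun _ h ↦ h, rfl, not_hasADR_compl hI⟩

theorem exists_mk_eq_fodorStarNumber {I : Set (Set ℕ)} (hI : IsIdeal I) :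
    ∃ H : Set (Set ℕ), (∀ A ∈ H, A ∉ I) ∧ Cardinal.mk H = fodorStarNumber I ∧ ¬ HasFinADR I H :=
  csInf_mem
    (s := {c | ∃ H : Set (Set ℕ), (∀ A ∈ H, A ∉ I) ∧ Cardinal.mk H = c ∧ ¬ HasFinADR I H})
    ⟨_, Iᶜ, fun _ h ↦ h, rfl, fun h ↦ not_hasADR_compl hI (h.hasADR hI.1)⟩

theorem fodorStarNumber_le_fodorNumber {I : Set (Set ℕ)} (hI : IsIdeal I) :
    fodorStarNumber I ≤ fodorNumber I := by
  obtain ⟨H, hH, hcard, hnot⟩ := exists_mk_eq_fodorNumber hI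
  exact csInf_le' ⟨H, hH, hcard, fun h ↦ hnot (h.hasADR hI.1)⟩

theorem stmt6 (I : Set (Set ℕ)) (hI : IsIdeal I) (htall : Tall I) :
    (addStar I < fodorNumber I → addStar I < fodorStarNumber I) ∧
    (addStar I = fodorNumber I → fodorNumber I = fodorStarNumber I) := by
  obtain ⟨H, hH, hcard, hnot⟩ := exists_mk_eq_fodorStarNumber hI
  have key (hle : fodorStarNumber I ≤ addStar I) : fodorNumber I ≤ fodorStarNumber I := by
    by_contra! hlt
    rw [← hcard] at hle hlt
    exact hnot ((hasADR_of_lt_fodorNumber hH hlt).hasFinADR_of_le_addStar hI hle)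
  refine ⟨fun hlt ↦ ?_, fun heq ↦ ?_⟩
  · by_contra! hle
    exact (hlt.trans_le (key hle)).not_ge hle
  · have hle := fodorStarNumber_le_fodorNumber hI
    exact (key (hle.trans_eq heq.symm)).antisymm hle
end

section
/- Let I₀ = {A ⊆ ω×ω : for all infinite X, Y ⊆ ω there exist infinite X' ⊆ X and Y' ⊆ Y with A ∩ (X'×Y') = ∅}. Then I₀ is an ideal on ω×ω (it contains all finite subsets of ω×ω, is closed under subsets and finite unions, and ω×ω ∉ I₀), I₀ is tall (every infinite A ⊆ ω×ω contains an infinite element of I₀), and I₀ is not a P-ideal: the sets n×ω belong to I₀ for every n ∈ ω, but every A ⊆ ω×ω with n×ω ⊆* A for all n satisfies A ∉ I₀. -/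
open Set

/-- The ideal `I₀` on `ω × ω`. -/
def I0 : Set (Set (ℕ × ℕ)) :=
  {A | ∀ X Y : Set ℕ, X.Infinite → Y.Infinite →
    ∃ X' ⊆ X, ∃ Y' ⊆ Y, X'.Infinite ∧ Y'.Infinite ∧ A ∩ (X' ×ˢ Y') = ∅}

theorem mem_I0_of_finite_image_fst {A : Set (ℕ × ℕ)} (hA : (Prod.fst '' A).Finite) :
    A ∈ I0 := by
  intro X Y hX hY
  refine ⟨X \ Prod.fst '' A, sdiff_subset, Y, Subset.rfl, hX.sdiff hA, hY, ?_⟩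
  rw [eq_empty_iff_forall_notMem]
  rintro p ⟨hp, hpX, -⟩
  exact hpX.2 (mem_image_of_mem _ hp)

theorem Set.Infinite.exists_disjoint_infinite_subsets {α : Type*} {Z : Set α}
    (hZ : Z.Infinite) :
    ∃ S ⊆ Z, ∃ T ⊆ Z, S.Infinite ∧ T.Infinite ∧ Disjoint S T := by
  obtain ⟨S, T, rfl, hST, hc⟩ := hZ.exists_union_disjoint_cardinal_eq_of_infinite
  have hiff : S.Infinite ↔ T.Infinite := by
    rw [← infinite_coe_iff, ← infinite_coe_iff, Cardinal.infinite_iff, Cardinal.infinite_iff, hc]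
  have hS : S.Infinite := (infinite_union.1 hZ).elim id hiff.2
  exact ⟨S, subset_union_left, T, subset_union_right, hS, hiff.1 hS, hST⟩

theorem setOf_snd_eq_mem_I0 (f : ℕ → ℕ) : {p : ℕ × ℕ | p.2 = f p.1} ∈ I0 := by
  intro X Y hX hY
  by_cases h : (f '' X ∩ Y).Finite
  · refine ⟨X, Subset.rfl, Y \ (f '' X ∩ Y), sdiff_subset, hX, hY.sdiff h, ?_⟩
    rw [eq_empty_iff_forall_notMem]
    rintro p ⟨hp, hx, hy⟩
    exact hy.2 ⟨⟨p.1, hx, hp.symm⟩, hy.1⟩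
  · obtain ⟨S, hS, T, hT, hSi, hTi, hST⟩ :=
      Set.Infinite.exists_disjoint_infinite_subsets h
    refine ⟨X ∩ f ⁻¹' S, inter_subset_left, T, hT.trans inter_subset_right, ?_, hTi, ?_⟩
    · refine Infinite.of_image f ?_
      rwa [image_inter_preimage, inter_eq_right.2 (hS.trans inter_subset_left)]
    · rw [eq_empty_iff_forall_notMem]
      rintro p ⟨hp, hx, hy⟩
      exact disjoint_left.1 hST hx.2 (hp ▸ hy)

theorem mem_I0_of_subset {A B : Set (ℕ × ℕ)} (hAB : A ⊆ B) (hB : B ∈ I0) : A ∈ I0 := by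
  intro X Y hX hY
  obtain ⟨X', hX', Y', hY', hXi, hYi, h⟩ := hB X Y hX hY
  exact ⟨X', hX', Y', hY', hXi, hYi,
    subset_empty_iff.1 (h ▸ inter_subset_inter_left _ hAB)⟩

theorem union_mem_I0 {A B : Set (ℕ × ℕ)} (hA : A ∈ I0) (hB : B ∈ I0) : A ∪ B ∈ I0 := by
  intro X Y hX hY
  obtain ⟨X₁, hX₁, Y₁, hY₁, hXi₁, hYi₁, h₁⟩ := hA X Y hX hY
  obtain ⟨X₂, hX₂, Y₂, hY₂, hXi₂, hYi₂, h₂⟩ := hB X₁ Y₁ hXi₁ hYi₁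
  refine ⟨X₂, hX₂.trans hX₁, Y₂, hY₂.trans hY₁, hXi₂, hYi₂, ?_⟩
  rw [union_inter_distrib_right, h₂, union_empty]
  exact subset_empty_iff.1 (h₁ ▸ inter_subset_inter_right _ (prod_mono hX₂ hY₂))

theorem notMem_I0_of_finite_sdiff {A : Set (ℕ × ℕ)}
    (hA : ∀ n : ℕ, ((Set.Iio n ×ˢ (univ : Set ℕ)) \ A).Finite) : A ∉ I0 := by
  intro h
  obtain ⟨X, -, Y, -, hX, hY, hXY⟩ := h univ univ infinite_univ infinite_univ
  obtain ⟨k, hk⟩ := hX.nonempty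
  refine (hY.image (f := Prod.mk k) (Prod.mk_right_injective k).injOn) ((hA (k + 1)).subset ?_)
  rintro _ ⟨y, hy, rfl⟩
  exact ⟨⟨Nat.lt_succ_self k, mem_univ y⟩,
    fun hA' => eq_empty_iff_forall_notMem.1 hXY _ ⟨hA', hk, hy⟩⟩

theorem isIdeal_I0 : IsIdeal I0 :=
  ⟨fun _ hA => mem_I0_of_finite_image_fst (hA.image _), fun _ _ => mem_I0_of_subset,
    fun _ _ => union_mem_I0, notMem_I0_of_finite_sdiff fun n => by simp⟩

theorem exists_infinite_subset_mem_I0 {A : Set (ℕ × ℕ)} (hA : A.Infinite) :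
    ∃ B ⊆ A, B.Infinite ∧ B ∈ I0 := by
  by_cases h : (Prod.fst '' A).Finite
  · exact ⟨A, Subset.rfl, hA, mem_I0_of_finite_image_fst h⟩
  · have hex : ∀ x, ∃ y, x ∈ Prod.fst '' A → (x, y) ∈ A := fun x => by
      by_cases hx : x ∈ Prod.fst '' A
      · obtain ⟨⟨x, y⟩, hp, rfl⟩ := hx
        exact ⟨y, fun _ => hp⟩
      · exact ⟨0, fun h => absurd h hx⟩
    choose f hf using hex
    refine ⟨A ∩ {p | p.2 = f p.1}, inter_subset_left, ?_,
      mem_I0_of_subset inter_subset_right (setOf_snd_eq_mem_I0 f)⟩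
    refine Infinite.of_image Prod.fst (Infinite.mono ?_ h)
    exact fun x hx => ⟨(x, f x), ⟨hf x hx, rfl⟩, rfl⟩


/-- `I₀` is a tall ideal on `ω × ω` which is not a P-ideal, as witnessed by the sets
`n × ω`. -/
theorem stmt9 :
    IsIdeal I0 ∧
    (∀ A : Set (ℕ × ℕ), A.Infinite → ∃ B ⊆ A, B.Infinite ∧ B ∈ I0) ∧
    (∀ n : ℕ, (Set.Iio n ×ˢ (univ : Set ℕ)) ∈ I0) ∧
    (∀ A : Set (ℕ × ℕ), (∀ n : ℕ, ((Set.Iio n ×ˢ (univ : Set ℕ)) \ A).Finite) → A ∉ I0) := by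
  exact ⟨isIdeal_I0, fun A => exists_infinite_subset_mem_I0,
    fun n => mem_I0_of_finite_image_fst ((finite_Iio n).subset (fst_image_prod_subset _ _)),
    fun A => notMem_I0_of_finite_sdiff⟩
end

section
/- Let I₀ = {A ⊆ ω×ω : for all infinite X, Y ⊆ ω there exist infinite X' ⊆ X and Y' ⊆ Y with A ∩ (X'×Y') = ∅}. For infinite X, Y ⊆ ω define T↑(X,Y) = {(n,k) ∈ X×Y : n < k} and T↓(X,Y) = {(n,k) ∈ X×Y : n > k}. Then for every A ⊆ ω×ω: A ∈ I₀ if and only if for all infinite X, Y ⊆ ω, A contains neither T↑(X,Y) nor T↓(X,Y). -/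
open Set

/-- `T↑(X,Y) = {(n,k) ∈ X×Y : n < k}`. -/
def Tup (X Y : Set ℕ) : Set (ℕ × ℕ) := {p | p ∈ X ×ˢ Y ∧ p.1 < p.2}

/-- `T↓(X,Y) = {(n,k) ∈ X×Y : n > k}`. -/
def Tdown (X Y : Set ℕ) : Set (ℕ × ℕ) := {p | p ∈ X ×ˢ Y ∧ p.2 < p.1}

/-- Infinite Ramsey theorem for pairs and two colours. -/
theorem exists_strictMono_homogeneous (r : ℕ → ℕ → Prop) :
    ∃ f : ℕ → ℕ, StrictMono f ∧
      ((∀ m n, m < n → r (f m) (f n)) ∨ ∀ m n, m < n → ¬ r (f m) (f n)) := by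
  have key : ∀ q : ℕ → ℕ → Prop,
      (∀ᶠ i in (Filter.hyperfilter ℕ : Filter ℕ),
        ∀ᶠ j in (Filter.hyperfilter ℕ : Filter ℕ), q i j) →
      ∃ f : ℕ → ℕ, StrictMono f ∧ ∀ m n, m < n → q (f m) (f n) := by
    intro q hq
    obtain ⟨f, -, hf⟩ := exists_seq_of_forall_finset_exists
      (fun i => ∀ᶠ j in (Filter.hyperfilter ℕ : Filter ℕ), q i j) (fun i j => i < j ∧ q i j) (by
        intro s hs
        have hlt : ∀ x ∈ s, ∀ᶠ j in (Filter.hyperfilter ℕ : Filter ℕ), x < j ∧ q x j := by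
          intro x hx
          refine Filter.Eventually.and ?_ (hs x hx)
          exact Nat.hyperfilter_le_atTop (Filter.eventually_gt_atTop x)
        exact (hq.and ((Filter.eventually_all_finset s).2 hlt)).exists)
    exact ⟨f, fun m n h => (hf m n h).1, fun m n h => (hf m n h).2⟩
  by_cases h : ∀ᶠ i in (Filter.hyperfilter ℕ : Filter ℕ),
      ∀ᶠ j in (Filter.hyperfilter ℕ : Filter ℕ), r i j
  · obtain ⟨f, hf, hr⟩ := key r h
    exact ⟨f, hf, Or.inl hr⟩
  · simp only [← Ultrafilter.eventually_not] at h
    obtain ⟨f, hf, hr⟩ := key (fun i j => ¬ r i j) h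
    exact ⟨f, hf, Or.inr hr⟩

/-- Infinite sets of naturals contain strictly increasing sequences which interleave. -/
theorem exists_interleaved_seq {X Y : Set ℕ} (hX : X.Infinite) (hY : Y.Infinite) :
    ∃ x y : ℕ → ℕ, (∀ n, x n ∈ X) ∧ (∀ n, y n ∈ Y) ∧ StrictMono x ∧ StrictMono y ∧
      ∀ m n, m < n → x m < y n ∧ y m < x n := by
  obtain ⟨f, hf, hr⟩ := exists_seq_of_forall_finset_exists
    (fun p : ℕ × ℕ => p.1 ∈ X ∧ p.2 ∈ Y)
    (fun p q => (p.1 < q.1 ∧ p.2 < q.2) ∧ p.1 < q.2 ∧ p.2 < q.1) (by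
      intro s _
      obtain ⟨a, ha, hsa⟩ := hX.exists_gt (s.sup fun p => p.1 + p.2)
      obtain ⟨b, hb, hsb⟩ := hY.exists_gt (s.sup fun p => p.1 + p.2)
      refine ⟨(a, b), ⟨ha, hb⟩, fun p hp => ?_⟩
      have := Finset.le_sup (f := fun p : ℕ × ℕ => p.1 + p.2) hp
      dsimp only at this ⊢
      omega)
  exact ⟨fun n => (f n).1, fun n => (f n).2, fun n => (hf n).1, fun n => (hf n).2,
    fun m n h => (hr m n h).1.1, fun m n h => (hr m n h).1.2, fun m n h => (hr m n h).2⟩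

/-- `A ∈ I₀` iff for all infinite `X, Y ⊆ ω`, `A` contains neither `T↑(X,Y)` nor
`T↓(X,Y)`. -/
theorem stmt10 (A : Set (ℕ × ℕ)) :
    A ∈ I0 ↔ ∀ X Y : Set ℕ, X.Infinite → Y.Infinite →
      ¬ Tup X Y ⊆ A ∧ ¬ Tdown X Y ⊆ A := by
  constructor
  · intro hA X Y hX hY
    obtain ⟨X', hXX, Y', hYY, hX', hY', hE⟩ := hA X Y hX hY
    constructor
    · intro hT
      obtain ⟨n, hn⟩ := hX'.nonempty
      obtain ⟨k, hk, hnk⟩ := hY'.exists_gt n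
      exact (Set.eq_empty_iff_forall_notMem.1 hE) (n, k)
        ⟨hT ⟨⟨hXX hn, hYY hk⟩, hnk⟩, hn, hk⟩
    · intro hT
      obtain ⟨k, hk⟩ := hY'.nonempty
      obtain ⟨n, hn, hnk⟩ := hX'.exists_gt k
      exact (Set.eq_empty_iff_forall_notMem.1 hE) (n, k)
        ⟨hT ⟨⟨hXX hn, hYY hk⟩, hnk⟩, hn, hk⟩
  · intro h X Y hX hY
    obtain ⟨x, y, hxX, hyY, hx, hy, hxy⟩ := exists_interleaved_seq hX hY
    obtain ⟨f, hf, hfr⟩ := exists_strictMono_homogeneous fun i j => (x i, y j) ∈ A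
    obtain ⟨g, hg, hgr⟩ := exists_strictMono_homogeneous fun i j => (x (f j), y (f i)) ∈ A
    have hfg : StrictMono (f ∘ g) := hf.comp hg
    have he : StrictMono fun i : ℕ => 2 * i := fun a b hab => by dsimp only; omega
    have ho : StrictMono fun i : ℕ => 2 * i + 1 := fun a b hab => by dsimp only; omega
    have hX' := Set.infinite_range_of_injective ((hx.comp hfg).comp he).injective
    have hY' := Set.infinite_range_of_injective ((hy.comp hfg).comp ho).injective
    obtain ⟨hup, hdown⟩ := h _ _ hX' hY'
    have hfr' : ∀ m n, m < n → (x (f (g m)), y (f (g n))) ∉ A := by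
      refine fun m n hmn => (hfr.resolve_left fun hr => hup ?_) _ _ (hg hmn)
      rintro ⟨_, _⟩ ⟨⟨⟨i, rfl⟩, ⟨j, rfl⟩⟩, hlt⟩
      refine hr _ _ (hg ?_)
      by_contra hle
      exact lt_asymm hlt (hxy _ _ (hfg (by dsimp only at hle ⊢; omega : 2 * j + 1 < 2 * i))).2
    have hgr' : ∀ m n, m < n → (x (f (g n)), y (f (g m))) ∉ A := by
      refine hgr.resolve_left fun hr => hdown ?_
      rintro ⟨_, _⟩ ⟨⟨⟨i, rfl⟩, ⟨j, rfl⟩⟩, hlt⟩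
      refine hr _ _ ?_
      by_contra hle
      exact lt_asymm hlt (hxy _ _ (hfg (by dsimp only at hle ⊢; omega : 2 * i < 2 * j + 1))).1
    refine ⟨_, ?_, _, ?_, hX', hY', ?_⟩
    · rintro _ ⟨i, rfl⟩
      exact hxX _
    · rintro _ ⟨i, rfl⟩
      exact hyY _
    · refine Set.eq_empty_iff_forall_notMem.2 ?_
      rintro ⟨_, _⟩ ⟨hA, ⟨i, rfl⟩, ⟨j, rfl⟩⟩
      rcases lt_or_gt_of_ne (by omega : 2 * i ≠ 2 * j + 1) with hlt | hlt
      · exact hfr' _ _ hlt hA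
      · exact hgr' _ _ hlt hA
end

section
/- Let 𝒱 be a family of infinite subsets of ω such that (a) 𝒱 is closed under finite modifications (if X ∈ 𝒱, X' ⊆ ω is infinite and the symmetric difference X △ X' is finite, then X' ∈ 𝒱), and (b) there is a partition of ω into infinitely many infinite sets all of which belong to 𝒱. Then the following are equivalent: (i) there exists f : ω → ω such that f[X] ∩ Y is infinite for all X, Y ∈ 𝒱 (an f mixing over 𝒱); (ii) there exists f : ω → ω such that f[X] = ω for all X ∈ 𝒱; (iii) there exists a partition (Y_n)_{n∈ω} of ω into infinitely many infinite sets such that X ∩ Y_n is infinite for every X ∈ 𝒱 and every n; (iii)' there exists a partition (Y_n)_{n∈ω} of ω into infinitely many infinite sets such that X ∩ Y_n ≠ ∅ for every X ∈ 𝒱 and every n. -/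
open Set

/-- `(Y_n)` is a partition of `ω` into infinitely many infinite sets. -/
def InfinitePartition (Y : ℕ → Set ℕ) : Prop :=
  (∀ n m : ℕ, n ≠ m → Disjoint (Y n) (Y m)) ∧ (∀ n, (Y n).Infinite) ∧ (⋃ n, Y n) = univ

/-- Characterizations of the existence of a mixing function over a family `𝒱` of
infinite subsets of `ω` which is closed under finite modifications and contains a
partition of `ω` into infinitely many infinite sets. -/
theorem stmt13 (𝒱 : Set (Set ℕ)) (h𝒱 : ∀ X ∈ 𝒱, X.Infinite)
    (hfin : ∀ X ∈ 𝒱, ∀ X' : Set ℕ, X'.Infinite → ((X \ X') ∪ (X' \ X)).Finite → X' ∈ 𝒱)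
    (hpart : ∃ P : ℕ → Set ℕ, InfinitePartition P ∧ ∀ n, P n ∈ 𝒱) :
    List.TFAE
      [ ∃ f : ℕ → ℕ, ∀ X ∈ 𝒱, ∀ Y ∈ 𝒱, (f '' X ∩ Y).Infinite,
        ∃ f : ℕ → ℕ, ∀ X ∈ 𝒱, f '' X = univ,
        ∃ Y : ℕ → Set ℕ, InfinitePartition Y ∧ ∀ X ∈ 𝒱, ∀ n : ℕ, (X ∩ Y n).Infinite,
        ∃ Y : ℕ → Set ℕ, InfinitePartition Y ∧ ∀ X ∈ 𝒱, ∀ n : ℕ, (X ∩ Y n).Nonempty ] := by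
  obtain ⟨P, ⟨hPd, -, hPu⟩, hPV⟩ := hpart
  tfae_have 1 → 3 := by
    rintro ⟨f, hf⟩
    have key : ∀ X ∈ 𝒱, ∀ n, (X ∩ f ⁻¹' P n).Infinite := fun X hX n =>
      Infinite.of_image f (by rw [image_inter_preimage]; exact hf X hX _ (hPV n))
    refine ⟨fun n => f ⁻¹' P n, ⟨fun n m h => (hPd n m h).preimage f, fun n =>
      (key _ (hPV 0) n).mono inter_subset_right, ?_⟩, key⟩
    rw [← preimage_iUnion, hPu, preimage_univ]
  tfae_have 3 → 4 := by
    rintro ⟨Y, hY, h⟩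
    exact ⟨Y, hY, fun X hX n => (h X hX n).nonempty⟩
  tfae_have 4 → 2 := by
    rintro ⟨Y, ⟨hd, -, hu⟩, h⟩
    have hex : ∀ x, ∃ n, x ∈ Y n := fun x => mem_iUnion.1 (hu ▸ mem_univ x)
    choose f hf using hex
    refine ⟨f, fun X hX => eq_univ_of_forall fun n => ?_⟩
    obtain ⟨x, hxX, hxY⟩ := h X hX n
    refine ⟨x, hxX, ?_⟩
    by_contra hne
    exact disjoint_left.1 (hd _ _ hne) (hf x) hxY
  tfae_have 2 → 3 := by
    rintro ⟨f, hf⟩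
    have key : ∀ X ∈ 𝒱, ∀ n, (X ∩ f ⁻¹' {n}).Infinite := by
      intro X hX n hfinite
      have hmem : X \ (X ∩ f ⁻¹' {n}) ∈ 𝒱 :=
        hfin X hX _ ((h𝒱 X hX).sdiff hfinite) <| hfinite.subset fun x hx => by
          simp only [mem_union, mem_sdiff] at hx
          tauto
      obtain ⟨x, ⟨hxX, hx⟩, hxn⟩ := (hf _ hmem).symm ▸ mem_univ n
      exact hx ⟨hxX, hxn⟩
    refine ⟨fun n => f ⁻¹' {n}, ⟨fun n m h => (disjoint_singleton.2 h).preimage f, fun n =>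
      (key _ (hPV 0) n).mono inter_subset_right, ?_⟩, key⟩
    exact eq_univ_of_forall fun x => mem_iUnion.2 ⟨f x, rfl⟩
  tfae_have 2 → 1 := by
    rintro ⟨f, hf⟩
    refine ⟨f, fun X hX Y hY => ?_⟩
    rw [hf X hX, univ_inter]
    exact h𝒱 Y hY
  tfae_finish
end

section
/- Let 𝒱 be a family of infinite subsets of ω, let f : ω → ω be injective with f[X] ∩ Y infinite for all X, Y ∈ 𝒱, let 𝒜 ⊆ 𝒱 be an almost disjoint family (A ∩ B finite for all distinct A, B ∈ 𝒜), and let ι : 𝒱 → 𝒜 be an injective map. Then the family {f[ι(X)] ∩ X : X ∈ 𝒱} is an almost disjoint refinement of 𝒱: f[ι(X)] ∩ X is an infinite subset of X for every X ∈ 𝒱, and (f[ι(X)] ∩ X) ∩ (f[ι(X')] ∩ X') is finite for all distinct X, X' ∈ 𝒱. -/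
open Set

/-- If `f` is an injective mixing function over `𝒱`, `𝒜 ⊆ 𝒱` is an almost disjoint
family and `ι : 𝒱 → 𝒜` is injective, then `{f[ι(X)] ∩ X : X ∈ 𝒱}` is an almost
disjoint refinement of `𝒱`. -/
theorem stmt14 (𝒱 : Set (Set ℕ)) (h𝒱 : ∀ X ∈ 𝒱, X.Infinite)
    (f : ℕ → ℕ) (hf : Function.Injective f)
    (hmix : ∀ X ∈ 𝒱, ∀ Y ∈ 𝒱, (f '' X ∩ Y).Infinite)
    (𝒜 : Set (Set ℕ)) (h𝒜𝒱 : 𝒜 ⊆ 𝒱)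
    (hAD : ∀ A ∈ 𝒜, ∀ B ∈ 𝒜, A ≠ B → (A ∩ B).Finite)
    (ι : Set ℕ → Set ℕ) (hι : ∀ X ∈ 𝒱, ι X ∈ 𝒜)
    (hιinj : ∀ X ∈ 𝒱, ∀ X' ∈ 𝒱, ι X = ι X' → X = X') :
    (∀ X ∈ 𝒱, f '' (ι X) ∩ X ⊆ X ∧ (f '' (ι X) ∩ X).Infinite) ∧
    (∀ X ∈ 𝒱, ∀ X' ∈ 𝒱, X ≠ X' →
      ((f '' (ι X) ∩ X) ∩ (f '' (ι X') ∩ X')).Finite) := by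
  refine ⟨fun X hX => ⟨inter_subset_right, hmix _ (h𝒜𝒱 (hι X hX)) X hX⟩, ?_⟩
  intro X hX X' hX' hne
  have hfin : (f '' (ι X ∩ ι X')).Finite :=
    (hAD _ (hι X hX) _ (hι X' hX') fun h => hne (hιinj X hX X' hX' h)).image f
  rw [image_inter hf] at hfin
  exact hfin.subset (inter_subset_inter inter_subset_left inter_subset_left)
end

section
/- Let μ be the product probability measure on the Baire space ω^ω obtained as the countable product, over all coordinates n ∈ ω, of the probability measure ν on ω given by ν({m}) = 2^{−(m+1)}. Then for all infinite sets X, Y ⊆ ω, the set A_{X,Y} = {f ∈ ω^ω : f[X] ∩ Y is finite} is a μ-null set. -/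
open Set MeasureTheory

/-- If all coordinates in the infinite set `X` have probability `p ≠ 0` of being equal to `y`,
independently of each other, then almost surely some coordinate in `X` equals `y`. -/
theorem measure_forall_ne_eq_zero {μ : Measure (ℕ → ℕ)} [IsProbabilityMeasure μ]
    {y : ℕ} {p : ENNReal} (hp : p ≠ 0)
    (hμ : ∀ t : Finset ℕ, μ {f : ℕ → ℕ | ∀ i ∈ t, f i = y} = p ^ t.card)
    {X : Set ℕ} (hX : X.Infinite) :
    μ {f : ℕ → ℕ | ∀ x ∈ X, f x ≠ y} = 0 := by
  let e := hX.natEmbedding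
  let s : ℕ → Set (ℕ → ℕ) := fun n ↦ {f | f (e n) = y}
  have hs : ∀ n, MeasurableSet (s n) := fun n ↦
    (measurable_pi_apply (e n : ℕ) : Measurable fun f : ℕ → ℕ ↦ f (e n))
      (measurableSet_singleton y)
  have hsμ : ∀ n, μ (s n) = p := fun n ↦ by simpa [s] using hμ {(e n : ℕ)}
  have he : Function.Injective fun n ↦ (e n : ℕ) := Subtype.val_injective.comp e.injective
  have hind : ProbabilityTheory.iIndepSet s μ := by
    rw [ProbabilityTheory.iIndepSet_iff_meas_biInter hs]
    intro t
    have hinter : ⋂ i ∈ t, s i = {f | ∀ i ∈ t.map ⟨_, he⟩, f i = y} := by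
      ext f
      simp [s]
    rw [hinter, hμ]
    simp [hsμ]
  have hone := ProbabilityTheory.measure_limsup_eq_one hs hind
    (by simp [hsμ, ENNReal.tsum_const_eq_top_of_ne_zero hp])
  rw [← prob_compl_eq_zero_iff (MeasurableSet.measurableSet_limsup hs)] at hone
  refine measure_mono_null ?_ hone
  intro f hf hlim
  rw [Filter.mem_limsup_iff_frequently_mem] at hlim
  obtain ⟨n, hn⟩ := hlim.exists
  exact hf _ (e n).2 hn

/-- Let `μ` be the product probability measure on the Baire space `ω^ω` whose
coordinate distributions are `ν({m}) = 2^{-(m+1)}`, i.e. a probability measure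
satisfying the product formula on cylinders. Then for all infinite `X, Y ⊆ ω`, the
set `{f : f[X] ∩ Y finite}` is `μ`-null. -/
theorem stmt17 (μ : Measure (ℕ → ℕ)) [IsProbabilityMeasure μ]
    (hμ : ∀ (t : Finset ℕ) (σ : ℕ → ℕ),
      μ {f : ℕ → ℕ | ∀ i ∈ t, f i = σ i} = ∏ i ∈ t, ((2 : ENNReal) ^ (σ i + 1))⁻¹)
    (X Y : Set ℕ) (hX : X.Infinite) (hY : Y.Infinite) :
    μ {f : ℕ → ℕ | (f '' X ∩ Y).Finite} = 0 := by
  have hnull : ∀ y, μ {f : ℕ → ℕ | ∀ x ∈ X, f x ≠ y} = 0 := fun y ↦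
    measure_forall_ne_eq_zero (p := ((2 : ENNReal) ^ (y + 1))⁻¹) (by simp)
      (fun t ↦ by simpa using hμ t fun _ ↦ y) hX
  refine measure_mono_null (fun f hf ↦ ?_) (measure_iUnion_null hnull)
  obtain ⟨y, hyY, hy⟩ := hY.exists_notMem_finite hf
  exact mem_iUnion.2 ⟨y, fun x hx hxy ↦ hy ⟨⟨x, hx, hxy⟩, hyY⟩⟩
end

section
/- Let INJ = {f ∈ ω^ω : f is injective}, equipped with the subspace topology inherited from the Baire space ω^ω. Then for all infinite sets X, Y ⊆ ω, the set {f ∈ INJ : f[X] ∩ Y is finite} is meager in INJ; in fact, for every n ∈ ω the set {f ∈ INJ : f[X] ∩ Y ⊆ {0,…,n−1}} is closed and nowhere dense in INJ. -/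
open Set

/-- The space of injective functions `ω → ω`, as a subspace of the Baire space. -/
def INJ : Type := {f : ℕ → ℕ // Function.Injective f}

instance : TopologicalSpace INJ :=
  instTopologicalSpaceSubtype

theorem INJ.continuous_val : Continuous (fun f : INJ => f.1) :=
  continuous_subtype_val

/-- Any injection can be modified, without changing its values on a given finite set, so that
some element of `X` is mapped to an element of `Y` that is at least `n`. -/
theorem INJ.exists_eqOn_finset {X Y : Set ℕ} (hX : X.Infinite) (hY : Y.Infinite) (n : ℕ)
    (f : INJ) (I : Finset ℕ) :
    ∃ g : INJ, (∀ i ∈ I, g.1 i = f.1 i) ∧ ∃ x ∈ X, g.1 x ∈ Y ∧ n ≤ g.1 x := by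
  obtain ⟨x, hxX, hxI⟩ := hX.exists_notMem_finset I
  obtain ⟨y, hyY, hy⟩ := hY.exists_notMem_finset (I.image f.1 ∪ Finset.range n)
  simp only [Finset.mem_union, Finset.mem_image, Finset.mem_range, not_or, not_exists, not_and,
    not_lt] at hy
  refine ⟨⟨Equiv.swap (f.1 x) y ∘ f.1, (Equiv.injective _).comp f.2⟩, fun i hi => ?_, x, hxX, ?_⟩
  · exact Equiv.swap_apply_of_ne_of_ne (fun h => hxI (f.2 h ▸ hi)) (hy.1 i hi)
  · simpa using ⟨hyY, hy.2⟩

theorem INJ.isClosed_image_inter_subset (X Y Z : Set ℕ) :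
    IsClosed {f : INJ | f.1 '' X ∩ Y ⊆ Z} := by
  have h : {f : INJ | f.1 '' X ∩ Y ⊆ Z} =
      ⋂ x ∈ X, (fun f : INJ => f.1 x) ⁻¹' {m | m ∈ Y → m ∈ Z} := by
    ext f
    simp only [mem_ofPred_eq, mem_iInter, mem_preimage]
    exact ⟨fun h x hx hy => h ⟨mem_image_of_mem _ hx, hy⟩,
      by rintro h _ ⟨⟨x, hx, rfl⟩, hy⟩; exact h x hx hy⟩
  rw [h]
  exact isClosed_biInter fun x _ =>
    (isClosed_discrete _).preimage ((continuous_apply x).comp INJ.continuous_val)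

theorem INJ.isNowhereDense_image_inter_subset_Iio {X Y : Set ℕ} (hX : X.Infinite)
    (hY : Y.Infinite) (n : ℕ) : IsNowhereDense {f : INJ | f.1 '' X ∩ Y ⊆ Iio n} := by
  rw [(INJ.isClosed_image_inter_subset X Y _).isNowhereDense_iff, eq_empty_iff_forall_notMem]
  intro f hf
  obtain ⟨U, hUs, hU, hfU⟩ := mem_interior.1 hf
  obtain ⟨V, hV, rfl⟩ := isOpen_induced_iff.1 hU
  obtain ⟨I, u, hu, huV⟩ := isOpen_pi_iff.1 hV f.1 hfU
  obtain ⟨g, hg, x, hx, hy, hn⟩ := INJ.exists_eqOn_finset hX hY n f I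
  have hgV : g.1 ∈ V := huV fun i hi => (hg i hi).symm ▸ (hu i hi).2
  exact absurd (hUs hgV ⟨mem_image_of_mem _ hx, hy⟩) hn.not_gt

/-- For all infinite `X, Y ⊆ ω`, each set `{f ∈ INJ : f[X] ∩ Y ⊆ {0,…,n−1}}` is closed
and nowhere dense in `INJ`, and hence `{f ∈ INJ : f[X] ∩ Y finite}` is meager in
`INJ`. -/
theorem stmt18 (X Y : Set ℕ) (hX : X.Infinite) (hY : Y.Infinite) :
    (∀ n : ℕ, IsClosed {f : INJ | f.1 '' X ∩ Y ⊆ Set.Iio n} ∧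
      IsNowhereDense {f : INJ | f.1 '' X ∩ Y ⊆ Set.Iio n}) ∧
    IsMeagre {f : INJ | (f.1 '' X ∩ Y).Finite} := by
  have hnd := INJ.isNowhereDense_image_inter_subset_Iio hX hY
  refine ⟨fun n => ⟨INJ.isClosed_image_inter_subset X Y _, hnd n⟩, ?_⟩
  refine (isMeagre_iUnion fun n => (hnd n).isMeagre).mono fun f hf => mem_iUnion.2 ?_
  obtain ⟨b, hb⟩ := Set.Finite.bddAbove hf
  exact ⟨b + 1, fun m hm => Nat.lt_succ_of_le (hb hm)⟩
end

section
/- For 2 ≤ n < ω, let 𝔰_n denote the least cardinality of a family 𝒮 of partitions of ω into n infinite sets such that for every infinite X ⊆ ω there is a partition (P_0,…,P_{n−1}) ∈ 𝒮 with X ∩ P_k infinite for every k < n. Let 𝔰 denote the splitting number, i.e. the least cardinality of a family S of subsets of ω such that for every infinite X ⊆ ω there is S ∈ S with both X ∩ S and X \ S infinite. Then 𝔰_n = 𝔰 for every n with 2 ≤ n < ω. -/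
open Set

/-- `(P_0, …, P_{n−1})` is a partition of `ω` into `n` infinite sets. -/
def IsNPartition {n : ℕ} (P : Fin n → Set ℕ) : Prop :=
  (∀ i j : Fin n, i ≠ j → Disjoint (P i) (P j)) ∧ (∀ i, (P i).Infinite) ∧
    (⋃ i, P i) = univ

/-- `𝔰_n`: the least cardinality of a family `𝒮` of partitions of `ω` into `n` infinite
sets such that every infinite `X ⊆ ω` is split into `n` infinite pieces by some member
of `𝒮`. -/
noncomputable def sPartNumber (n : ℕ) : Cardinal :=
  sInf {c | ∃ 𝒮 : Set (Fin n → Set ℕ), Cardinal.mk 𝒮 = c ∧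
    (∀ P ∈ 𝒮, IsNPartition P) ∧
    ∀ X : Set ℕ, X.Infinite → ∃ P ∈ 𝒮, ∀ i, (X ∩ P i).Infinite}

/-- The splitting number `𝔰`. -/
noncomputable def splittingNumber : Cardinal :=
  sInf {c | ∃ 𝒮 : Set (Set ℕ), Cardinal.mk 𝒮 = c ∧
    ∀ X : Set ℕ, X.Infinite → ∃ S ∈ 𝒮, (X ∩ S).Infinite ∧ (X \ S).Infinite}

/-- The family `S` splits every infinite set of naturals. -/
def IsSplittingFamily (S : Set (Set ℕ)) : Prop :=
  ∀ X : Set ℕ, X.Infinite → ∃ A ∈ S, (X ∩ A).Infinite ∧ (X \ A).Infinite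

theorem IsSplittingFamily.infinite {S : Set (Set ℕ)} (hS : IsSplittingFamily S) :
    S.Infinite := by
  intro hfin
  have : Finite S := hfin
  obtain ⟨c, hc⟩ := Finite.exists_infinite_fiber (fun (m : ℕ) (A : S) => m ∈ A.1)
  obtain ⟨A, hA, h1, h2⟩ := hS _ (Set.infinite_coe_iff.mp hc)
  obtain ⟨x, hx, hxA⟩ := h1.nonempty
  obtain ⟨y, hy, hyA⟩ := h2.nonempty
  simp only [mem_preimage, mem_singleton_iff] at hx hy
  have h : (x ∈ A) = (y ∈ A) := congrFun (hx.trans hy.symm) ⟨A, hA⟩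
  exact hyA (h ▸ hxA)

theorem isSplittingFamily_univ : IsSplittingFamily univ := by
  intro X hX
  have := hX.to_subtype
  obtain ⟨f⟩ : Nonempty (ℕ ↪ X) := ⟨Infinite.natEmbedding X⟩
  have hf : Function.Injective (fun k => (f k : ℕ)) := Subtype.val_injective.comp f.injective
  refine ⟨range (fun k => (f (2 * k) : ℕ)), mem_univ _, ?_, ?_⟩
  · refine (infinite_range_of_injective (f := fun k => (f (2 * k) : ℕ)) ?_).mono ?_
    · intro a b h
      have := hf h
      omega
    · rintro _ ⟨k, rfl⟩
      exact ⟨(f _).2, k, rfl⟩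
  · refine (infinite_range_of_injective (f := fun k => (f (2 * k + 1) : ℕ)) ?_).mono ?_
    · intro a b h
      have := hf h
      omega
    · rintro _ ⟨k, rfl⟩
      refine ⟨(f _).2, ?_⟩
      rintro ⟨j, hj⟩
      have := hf hj
      omega

theorem IsSplittingFamily.splittingNumber_le_mk {S : Set (Set ℕ)} (hS : IsSplittingFamily S) :
    splittingNumber ≤ Cardinal.mk S :=
  csInf_le (OrderBot.bddBelow _) ⟨S, rfl, hS⟩

theorem exists_isSplittingFamily_mk_eq :
    ∃ S : Set (Set ℕ), Cardinal.mk S = splittingNumber ∧ IsSplittingFamily S :=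
  csInf_mem (s := {c | ∃ S : Set (Set ℕ), Cardinal.mk S = c ∧ IsSplittingFamily S})
    ⟨_, univ, rfl, isSplittingFamily_univ⟩

/-- Every infinite set of naturals meets all pieces of some member of `T`, a family of
partitions into `n` infinite sets, in infinite sets. -/
def IsPartSplittingFamily {n : ℕ} (T : Set (Fin n → Set ℕ)) : Prop :=
  (∀ P ∈ T, IsNPartition P) ∧ ∀ X : Set ℕ, X.Infinite → ∃ P ∈ T, ∀ i, (X ∩ P i).Infinite

theorem IsPartSplittingFamily.sPartNumber_le_mk {n : ℕ} {T : Set (Fin n → Set ℕ)}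
    (hT : IsPartSplittingFamily T) : sPartNumber n ≤ Cardinal.mk T :=
  csInf_le (OrderBot.bddBelow _) ⟨T, rfl, hT⟩

theorem IsNPartition.cons_diff {n : ℕ} {P : Fin n → Set ℕ} {A : Set ℕ} (hP : IsNPartition P)
    (hA : A.Infinite) (hPA : ∀ i, (P i \ A).Infinite) :
    IsNPartition (Fin.cons A (fun i => P i \ A) : Fin (n + 1) → Set ℕ) := by
  obtain ⟨hd, -, hu⟩ := hP
  refine ⟨?_, ?_, ?_⟩
  · intro i j hij
    induction i using Fin.cases with
    | zero =>
      induction j using Fin.cases with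
      | zero => exact absurd rfl hij
      | succ j => simpa using disjoint_sdiff_right
    | succ i =>
      induction j using Fin.cases with
      | zero => simpa using disjoint_sdiff_left
      | succ j =>
        simpa using (hd i j fun h => hij (congrArg Fin.succ h)).mono sdiff_subset sdiff_subset
  · intro i
    induction i using Fin.cases with
    | zero => simpa using hA
    | succ i => simpa using hPA i
  · refine eq_univ_of_forall fun x => mem_iUnion.mpr ?_
    by_cases hx : x ∈ A
    · exact ⟨0, by simpa using hx⟩
    · obtain ⟨i, hi⟩ := mem_iUnion.mp (hu ▸ mem_univ x)
      exact ⟨i.succ, by simpa using ⟨hi, hx⟩⟩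

theorem IsSplittingFamily.exists_isPartSplittingFamily {S : Set (Set ℕ)}
    (hS : IsSplittingFamily S) (n : ℕ) :
    ∃ T : Set (Fin (n + 1) → Set ℕ),
      Cardinal.mk T ≤ Cardinal.mk S ∧ IsPartSplittingFamily T := by
  have hinf : Cardinal.aleph0 ≤ Cardinal.mk S := Cardinal.infinite_iff.mp hS.infinite.to_subtype
  induction n with
  | zero =>
    refine ⟨{fun _ => univ}, ?_, ?_, fun X hX => ⟨_, rfl, fun _ => by simpa using hX⟩⟩
    · rw [Cardinal.mk_singleton]
      exact Cardinal.one_le_aleph0.trans hinf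
    · rintro _ rfl
      exact ⟨fun i j hij => absurd (Fin.ext (by omega)) hij, fun _ => infinite_univ,
        iUnion_const univ⟩
  | succ n ih =>
    obtain ⟨T, hTS, hT, hT'⟩ := ih
    let F : S × T → Fin (n + 2) → Set ℕ := fun p => Fin.cons p.1.1 (fun i => p.2.1 i \ p.1.1)
    refine ⟨range F ∩ {P | IsNPartition P}, ?_, fun P hP => hP.2, fun X hX => ?_⟩
    · calc Cardinal.mk ↑(range F ∩ {P | IsNPartition P})
          ≤ Cardinal.mk (range F) := Cardinal.mk_le_mk_of_subset inter_subset_left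
        _ ≤ Cardinal.mk (S × T) := Cardinal.mk_range_le
        _ = Cardinal.mk S * Cardinal.mk T := Cardinal.mul_def _ _ |>.symm
        _ ≤ Cardinal.mk S * Cardinal.mk S := mul_le_mul_right hTS _
        _ = Cardinal.mk S := Cardinal.mul_eq_self hinf
    · obtain ⟨A, hA, hXA, hXA'⟩ := hS X hX
      obtain ⟨P, hP, hXP⟩ := hT' _ hXA'
      have hPA : ∀ i, (X ∩ (P i \ A)).Infinite := fun i =>
        (hXP i).mono fun x hx => ⟨hx.1.1, hx.2, hx.1.2⟩
      refine ⟨F (⟨A, hA⟩, ⟨P, hP⟩), ⟨mem_range_self _, (hT P hP).cons_diff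
        (hXA.mono inter_subset_right) fun i => (hPA i).mono inter_subset_right⟩, fun i => ?_⟩
      induction i using Fin.cases with
      | zero => simpa [F] using hXA
      | succ i => simpa [F] using hPA i

theorem IsPartSplittingFamily.isSplittingFamily {n : ℕ} {T : Set (Fin n → Set ℕ)}
    (hT : IsPartSplittingFamily T) {i j : Fin n} (hij : i ≠ j) :
    IsSplittingFamily ((fun P => P i) '' T) := by
  intro X hX
  obtain ⟨P, hP, hXP⟩ := hT.2 X hX
  refine ⟨P i, mem_image_of_mem _ hP, hXP i, (hXP j).mono fun x hx => ⟨hx.1, fun hxi => ?_⟩⟩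
  exact disjoint_left.mp ((hT.1 P hP).1 i j hij) hxi hx.2

/-- `𝔰_n = 𝔰` for every `n` with `2 ≤ n < ω`. -/
theorem stmt19 : ∀ n : ℕ, 2 ≤ n → sPartNumber n = splittingNumber := by
  intro n hn
  obtain ⟨m, rfl⟩ := Nat.exists_eq_add_of_le' hn
  obtain ⟨S, hSc, hS⟩ := exists_isSplittingFamily_mk_eq
  obtain ⟨T, hTS, hT⟩ := hS.exists_isPartSplittingFamily (m + 1)
  refine le_antisymm ?_ (le_csInf ⟨_, T, rfl, hT⟩ ?_)
  · exact hT.sPartNumber_le_mk.trans (hTS.trans_eq hSc)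
  · rintro _ ⟨U, rfl, hU⟩
    have hU : IsPartSplittingFamily U := hU
    exact (hU.isSplittingFamily zero_ne_one).splittingNumber_le_mk.trans Cardinal.mk_image_le
end
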